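/- For every integer n ≥ 3 there exists ε₂ = ε₂(n) > 0 such that the following holds: if K ⊆ ℝⁿ is a C¹ ε₂-perturbation of a ball and K is axially symmetric, i.e. invariant under all rotations of ℝⁿ fixing some line, then (∫_{∂K} H⁺ dH^{n-1})^{1/(n-2)} / Per(K)^{1/(n-1)} ≥ ((n-1)·H^{n-1}(S^{n-1}))^{1/(n-2)} / Per(B₁)^{1/(n-1)}, where B₁ is the unit ball of ℝⁿ. -/

import Mathlib

open MeasureTheory Metric Set Real
open scoped ENNReal RealInnerProductSpace

noncomputable section

abbrev Euc (n : ℕ) := EuclideanSpace ℝ (Fin n)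

/-- Divergence of a vector field on Euclidean space: trace of its Fréchet derivative. -/
def divg {n : ℕ} (W : Euc n → Euc n) (x : Euc n) : ℝ :=
  LinearMap.trace ℝ (Euc n) (fderiv ℝ W x).toLinearMap

/-- A bounded domain with smooth boundary, encoded by a smooth defining function `F`:
the domain is `{F < 0}` and its boundary is `{F = 0}`, on which `0` is a regular value. -/
structure SmoothBody (n : ℕ) where
  F : Euc n → ℝ
  smooth : ContDiff ℝ (⊤ : ℕ∞) F
  bounded : Bornology.IsBounded {x : Euc n | F x ≤ 0}
  connected : IsConnected {x : Euc n | F x < 0}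
  regular : ∀ x : Euc n, F x = 0 → gradient F x ≠ 0

namespace SmoothBody

variable {n : ℕ} (K : SmoothBody n)

/-- The (open) domain `K`. -/
def body : Set (Euc n) := {x : Euc n | K.F x < 0}

/-- The boundary `∂K`. -/
def bdry : Set (Euc n) := {x : Euc n | K.F x = 0}

/-- The outer unit normal to `∂K` (extended to a neighbourhood as the normalized
gradient of the defining function). -/
def normal (x : Euc n) : Euc n := ‖gradient K.F x‖⁻¹ • gradient K.F x

/-- The mean curvature of `∂K` (trace of the second fundamental form with respect to the
outer unit normal), computed as the divergence of the unit normal field. -/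
def meanCurv (x : Euc n) : ℝ := divg K.normal x

/-- The orthogonal projection onto the hyperplane orthogonal to `ν`, as a linear map. -/
def tangentProj (ν : Euc n) : Euc n →ₗ[ℝ] Euc n :=
  LinearMap.id - LinearMap.smulRight (innerSL ℝ ν).toLinearMap ν

/-- The shape operator (Weingarten map) of `∂K` at `x`, extended by `0` on the normal
direction: `P ∘ Dν ∘ P` with `P` the orthogonal projection on the tangent space
`(ν x)^⊥` of `∂K`. Its eigenvalues are the principal curvatures of `∂K` together
with one extra `0`. -/
def shapeOp (x : Euc n) : Euc n →ₗ[ℝ] Euc n :=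
  (tangentProj (K.normal x)) ∘ₗ (fderiv ℝ K.normal x).toLinearMap ∘ₗ (tangentProj (K.normal x))

/-- The nuclear norm `‖II‖₁` of the second fundamental form of `∂K` at `x`: the sum of the
absolute values of the principal curvatures (eigenvalues of the shape operator). -/
def nuclearNormII (x : Euc n) : ℝ :=
  let M := LinearMap.toMatrix (EuclideanSpace.basisFun (Fin n) ℝ).toBasis
      (EuclideanSpace.basisFun (Fin n) ℝ).toBasis (K.shapeOp x)
  if h : M.IsHermitian then ∑ i, |h.eigenvalues i| else 0

/-- The perimeter of `K`: the `(n-1)`-dimensional Hausdorff measure of `∂K`. -/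
def perim : ℝ := (μH[(n : ℝ) - 1] K.bdry).toReal

/-- `K` is a `C¹` `ε`-perturbation of a ball: for some `x̄ ∈ ℝⁿ`, the outer unit normal
satisfies `|ν(x) - (x - x̄)/|x - x̄|| ≤ ε` for every `x ∈ ∂K`. -/
def IsPerturbedBall (ε : ℝ) : Prop :=
  ∃ c : Euc n, ∀ x ∈ K.bdry, ‖K.normal x - ‖x - c‖⁻¹ • (x - c)‖ ≤ ε

end SmoothBody

/-- The area of the unit sphere `S^{n-1} ⊆ ℝⁿ`, i.e. its `(n-1)`-dimensional Hausdorff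
measure (which is also the perimeter of the unit ball `B₁`). -/
def sphereArea (n : ℕ) : ℝ := (μH[(n : ℝ) - 1] (sphere (0 : Euc n) 1)).toReal

/-- `K` is axially symmetric: it is invariant under all rotations of `ℝⁿ` fixing some
line `{p + t • d : t ∈ ℝ}`. -/
def AxiallySymmetric {n : ℕ} (K : Set (Euc n)) : Prop :=
  ∃ p d : Euc n, d ≠ 0 ∧
    ∀ R : Euc n ≃ₗᵢ[ℝ] Euc n, R d = d → ∀ y ∈ K, p + R (y - p) ∈ K

section

open scoped NNReal Topology

section HausdorffComparison

theorem hausdorffMeasure_image_le_of_dist_le {ι X Y : Type*} [MetricSpace X] [MetricSpace Y]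
    [MeasurableSpace X] [BorelSpace X] [MeasurableSpace Y] [BorelSpace Y]
    (f : ι → X) (g : ι → Y) (T : Set ι) (K : ℝ≥0) {d : ℝ} (hd : 0 ≤ d)
    (h : ∀ i ∈ T, ∀ j ∈ T, dist (f i) (f j) ≤ K * dist (g i) (g j)) :
    μH[d] (f '' T) ≤ (K : ℝ≥0∞) ^ d * μH[d] (g '' T) := by
  rcases T.eq_empty_or_nonempty with rfl | ⟨i₀, hi₀⟩
  · simp
  have : Nonempty ι := ⟨i₀⟩
  have hinv : ∀ i ∈ T, Function.invFunOn g T (g i) ∈ T ∧ g (Function.invFunOn g T (g i)) = g i :=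
    fun i hi => Function.invFunOn_pos ⟨i, hi, rfl⟩
  have hL : LipschitzOnWith K (fun y => f (Function.invFunOn g T y)) (g '' T) := by
    refine LipschitzOnWith.of_dist_le_mul ?_
    rintro _ ⟨i, hi, rfl⟩ _ ⟨j, hj, rfl⟩
    simpa [(hinv i hi).2, (hinv j hj).2] using h _ (hinv i hi).1 _ (hinv j hj).1
  have himg : (fun y => f (Function.invFunOn g T y)) '' (g '' T) = f '' T := by
    rw [image_image]
    refine image_congr fun i hi => ?_
    have := h _ (hinv i hi).1 _ hi
    rw [(hinv i hi).2, dist_self, mul_zero] at this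
    exact dist_le_zero.mp this
  rw [← himg]
  exact hL.hausdorffMeasure_image_le hd

theorem measure_le_of_locally_le {α : Type*} [TopologicalSpace α] [SecondCountableTopology α]
    [MeasurableSpace α] [OpensMeasurableSpace α] {μ ν : Measure α} {s : Set α}
    (h : ∀ x ∈ s, ∃ V : Set α, IsOpen V ∧ x ∈ V ∧
      ∀ B ⊆ V, MeasurableSet B → μ B ≤ ν B) {B : Set α} (hB : MeasurableSet B) (hBs : B ⊆ s) :
    μ B ≤ ν B := by
  choose! V hVo hxV hV using h
  obtain ⟨t, hts, htc, htU⟩ := TopologicalSpace.countable_cover_nhdsWithin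
    (f := V) (s := s) fun x hx => mem_nhdsWithin_of_mem_nhds ((hVo x hx).mem_nhds (hxV x hx))
  rcases t.eq_empty_or_nonempty with rfl | hne
  · have : B = ∅ := by
      apply eq_empty_of_subset_empty
      simpa using hBs.trans htU
    simp [this]
  obtain ⟨u, hu⟩ := htc.exists_eq_range hne
  have hus : ∀ i, u i ∈ s := fun i => hts (hu ▸ mem_range_self i)
  have hcover : B = ⋃ i, B ∩ disjointed (fun i => V (u i)) i := by
    rw [← inter_iUnion, iUnion_disjointed, eq_comm, inter_eq_left]
    refine (hBs.trans htU).trans ?_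
    rw [hu, biUnion_range]
  have hm : ∀ i, MeasurableSet (B ∩ disjointed (fun i => V (u i)) i) := fun i =>
    hB.inter (MeasurableSet.disjointed (fun i => (hVo _ (hus i)).measurableSet) i)
  have hd : Pairwise (Function.onFun Disjoint fun i => B ∩ disjointed (fun i => V (u i)) i) :=
    fun i j hij => ((disjoint_disjointed _) hij).mono inter_subset_right inter_subset_right
  rw [hcover, measure_iUnion hd hm, measure_iUnion hd hm]
  exact ENNReal.tsum_le_tsum fun i => hV _ (hus i) _
    (inter_subset_right.trans (disjointed_subset _ _)) (hm i)

end HausdorffComparison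

section Revolution

variable {E : Type*} [NormedAddCommGroup E] [InnerProductSpace ℝ E]

/-- The unit sphere of the hyperplane orthogonal to `e`. -/
def equator (e : E) : Set E := {ω | ‖ω‖ = 1 ∧ inner ℝ e ω = 0}

/-- The cylinder coordinates `(z, ω) ↦ ω + z e`. -/
def cylPoint (e : E) (p : ℝ × E) : E := p.2 + p.1 • e

/-- The point with polar angle `β` (measured from `-e`) and azimuth `ω` on the radial graph
with centre `c`, axis `e` and radius function `ρ`. -/
def revPoint (c e : E) (ρ : ℝ → ℝ) (p : ℝ × E) : E :=
  c + ρ p.1 • (sin p.1 • p.2 - cos p.1 • e)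

theorem dist_sq_cylPoint {e : E} (he : ‖e‖ = 1) {ω₁ ω₂ : E} (h₁ : ω₁ ∈ equator e)
    (h₂ : ω₂ ∈ equator e) (a b z₁ z₂ : ℝ) :
    ‖(a • ω₁ + z₁ • e) - (b • ω₂ + z₂ • e)‖ ^ 2
      = (a - b) ^ 2 + (z₁ - z₂) ^ 2 + a * b * ‖ω₁ - ω₂‖ ^ 2 := by
  have e1 : (a • ω₁ + z₁ • e) - (b • ω₂ + z₂ • e) = (a • ω₁ - b • ω₂) + (z₁ - z₂) • e := by
    module
  have o1 : inner ℝ ω₁ e = 0 := by rw [real_inner_comm]; exact h₁.2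
  have o2 : inner ℝ ω₂ e = 0 := by rw [real_inner_comm]; exact h₂.2
  rw [e1, norm_add_sq_real, norm_sub_sq_real, norm_sub_sq_real]
  simp only [inner_sub_left, inner_smul_left, inner_smul_right, o1, o2, norm_smul, he,
    h₁.1, h₂.1, mul_pow, Real.norm_eq_abs, sq_abs]
  simp
  ring

theorem revPoint_eq (c e : E) (ρ : ℝ → ℝ) (p : ℝ × E) :
    revPoint c e ρ p = c + ((ρ p.1 * sin p.1) • p.2 + (-(ρ p.1 * cos p.1)) • e) := by
  unfold revPoint
  module

/-- The speed of the meridian of a radial graph. -/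
def meridianSpeed (ρ : ℝ → ℝ) (β : ℝ) : ℝ := √(ρ β ^ 2 + deriv ρ β ^ 2)

theorem meridianSpeed_pos {ρ : ℝ → ℝ} (hpos : ∀ β, 0 < ρ β) (β : ℝ) : 0 < meridianSpeed ρ β := by
  have := hpos β
  unfold meridianSpeed
  positivity

theorem continuous_meridianSpeed {ρ : ℝ → ℝ} (hρ : ContDiff ℝ 1 ρ) :
    Continuous (meridianSpeed ρ) := by
  have := hρ.continuous
  have := hρ.continuous_deriv le_rfl
  unfold meridianSpeed
  fun_prop

theorem eventually_meridian_chord {ρ : ℝ → ℝ} (hρ : ContDiff ℝ 1 ρ) (hpos : ∀ β, 0 < ρ β)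
    (β₀ : ℝ) {L : ℝ} (hL : 1 < L) :
    ∀ᶠ q in 𝓝 (β₀, β₀),
      (ρ q.1 * sin q.1 - ρ q.2 * sin q.2) ^ 2 + (-(ρ q.1 * cos q.1) - -(ρ q.2 * cos q.2)) ^ 2
        ≤ L ^ 2 * (meridianSpeed ρ β₀ ^ 2 * (q.1 - q.2) ^ 2) ∧
      meridianSpeed ρ β₀ ^ 2 * (q.1 - q.2) ^ 2 ≤
        L ^ 2 * ((ρ q.1 * sin q.1 - ρ q.2 * sin q.2) ^ 2
          + (-(ρ q.1 * cos q.1) - -(ρ q.2 * cos q.2)) ^ 2) := by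
  set v := meridianSpeed ρ β₀ with hv
  have hvpos : 0 < v := meridianSpeed_pos hpos β₀
  let γ : ℝ → WithLp 2 (ℝ × ℝ) := fun β => WithLp.toLp 2 (ρ β * sin β, -(ρ β * cos β))
  have hγ : ContDiff ℝ 1 γ := by
    have : ContDiff ℝ 1 (fun β => (ρ β * sin β, -(ρ β * cos β))) := by fun_prop
    exact (WithLp.prodContinuousLinearEquiv 2 ℝ ℝ ℝ).symm.contDiff.comp this
  have hstrict := (hγ.contDiffAt (x := β₀)).hasStrictDerivAt one_ne_zero
  have hρd : HasDerivAt ρ (deriv ρ β₀) β₀ := (hρ.differentiable one_ne_zero β₀).hasDerivAt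
  have hder : deriv γ β₀ = WithLp.toLp 2 (deriv ρ β₀ * sin β₀ + ρ β₀ * cos β₀,
      -(deriv ρ β₀ * cos β₀ + ρ β₀ * -sin β₀)) := by
    refine HasDerivAt.deriv ?_
    have h1 : HasDerivAt (fun β => (ρ β * sin β, -(ρ β * cos β)))
        (deriv ρ β₀ * sin β₀ + ρ β₀ * cos β₀, -(deriv ρ β₀ * cos β₀ + ρ β₀ * -sin β₀)) β₀ :=
      (hρd.mul (hasDerivAt_sin β₀)).prodMk (hρd.mul (hasDerivAt_cos β₀)).neg
    exact (WithLp.prodContinuousLinearEquiv 2 ℝ ℝ ℝ).symm.toContinuousLinearMap.hasFDerivAt.comp_hasDerivAt β₀ h1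
  have hnorm : ‖deriv γ β₀‖ = v := by
    rw [hder, WithLp.prod_norm_eq_of_L2, hv, meridianSpeed]
    congr 1
    simp only [Real.norm_eq_abs, sq_abs, WithLp.toLp_fst, WithLp.toLp_snd]
    linear_combination (ρ β₀ ^ 2 + deriv ρ β₀ ^ 2) * sin_sq_add_cos_sq β₀
  have hsq : ∀ q : ℝ × ℝ, ‖γ q.1 - γ q.2‖ ^ 2 =
      (ρ q.1 * sin q.1 - ρ q.2 * sin q.2) ^ 2 + (-(ρ q.1 * cos q.1) - -(ρ q.2 * cos q.2)) ^ 2 := by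
    intro q
    rw [WithLp.prod_norm_sq_eq_of_L2]
    simp [γ]
  set δ := v * min (L - 1) (1 - L⁻¹) with hδ
  have hLinv : L⁻¹ < 1 := inv_lt_one_of_one_lt₀ hL
  have hδpos : 0 < δ := mul_pos hvpos (lt_min (by linarith) (by linarith))
  have hδ1 : v + δ ≤ L * v := by
    have := mul_le_mul_of_nonneg_left (min_le_left (L - 1) (1 - L⁻¹)) hvpos.le
    linarith
  have hδ2 : v ≤ L * (v - δ) := by
    have h1 := mul_le_mul_of_nonneg_left (min_le_right (L - 1) (1 - L⁻¹)) hvpos.le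
    have h2 : L⁻¹ * v ≤ v - δ := by linarith
    have h3 := mul_le_mul_of_nonneg_left h2 (by linarith : (0:ℝ) ≤ L)
    rwa [← mul_assoc, mul_inv_cancel₀ (by linarith), one_mul] at h3
  filter_upwards [hstrict.isLittleO.def hδpos] with q hq
  rw [ContinuousLinearMap.toSpanSingleton_apply] at hq
  rw [← hsq]
  have hn1 : ‖(q.1 - q.2) • deriv γ β₀‖ = v * |q.1 - q.2| := by
    rw [norm_smul, hnorm, Real.norm_eq_abs, mul_comm]
  rw [Real.norm_eq_abs] at hq
  have t1 := norm_le_insert' (γ q.1 - γ q.2) ((q.1 - q.2) • deriv γ β₀)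
  have t2 := norm_le_insert ((γ q.1 - γ q.2)) ((q.1 - q.2) • deriv γ β₀)
  have ab := abs_nonneg (q.1 - q.2)
  have u1 : ‖γ q.1 - γ q.2‖ ≤ L * (v * |q.1 - q.2|) := by nlinarith
  have u2 : v * |q.1 - q.2| ≤ L * ‖γ q.1 - γ q.2‖ := by
    have : (v - δ) * |q.1 - q.2| ≤ ‖γ q.1 - γ q.2‖ := by
      have := norm_sub_norm_le ((q.1 - q.2) • deriv γ β₀) (((q.1 - q.2) • deriv γ β₀) - (γ q.1 - γ q.2))
      rw [norm_sub_rev _ (γ q.1 - γ q.2)] at this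
      simp only [sub_sub_cancel] at this
      nlinarith
    nlinarith
  have e1 : v ^ 2 * (q.1 - q.2) ^ 2 = (v * |q.1 - q.2|) ^ 2 := by rw [mul_pow, sq_abs]
  rw [e1, ← mul_pow, ← mul_pow]
  exact ⟨pow_le_pow_left₀ (norm_nonneg _) u1 2, pow_le_pow_left₀ (by positivity) u2 2⟩

theorem exists_open_revPoint_bilipschitz {c e : E} (he : ‖e‖ = 1) {ρ : ℝ → ℝ}
    (hρ : ContDiff ℝ 1 ρ) (hpos : ∀ β, 0 < ρ β) {β₀ : ℝ} (hβ₀ : β₀ ∈ Ioo 0 π)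
    {L : ℝ} (hL : 1 < L) :
    ∃ V : Set ℝ, IsOpen V ∧ β₀ ∈ V ∧ V ⊆ Ioo 0 π ∧
      ∀ p ∈ V ×ˢ equator e, ∀ q ∈ V ×ˢ equator e,
        dist (revPoint c e ρ p) (revPoint c e ρ q) ≤
          L * (ρ β₀ * sin β₀) * dist
            (cylPoint e (meridianSpeed ρ β₀ / (ρ β₀ * sin β₀) * p.1, p.2))
            (cylPoint e (meridianSpeed ρ β₀ / (ρ β₀ * sin β₀) * q.1, q.2)) ∧
        ρ β₀ * sin β₀ * dist
            (cylPoint e (meridianSpeed ρ β₀ / (ρ β₀ * sin β₀) * p.1, p.2))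
            (cylPoint e (meridianSpeed ρ β₀ / (ρ β₀ * sin β₀) * q.1, q.2)) ≤
          L * dist (revPoint c e ρ p) (revPoint c e ρ q) := by
  set r := ρ β₀ * sin β₀ with hr
  have hrpos : 0 < r := mul_pos (hpos _) (sin_pos_of_mem_Ioo hβ₀)
  set v := meridianSpeed ρ β₀ with hv
  have hc : ContinuousAt (fun q : ℝ × ℝ => (ρ q.1 * sin q.1) * (ρ q.2 * sin q.2)) (β₀, β₀) := by
    have := hρ.continuous
    fun_prop
  have hL2 : 1 < L ^ 2 := one_lt_pow₀ hL two_ne_zero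
  have hval : (fun q : ℝ × ℝ => (ρ q.1 * sin q.1) * (ρ q.2 * sin q.2)) (β₀, β₀) = r ^ 2 := by
    simp only [hr]; ring
  have h1 : ∀ᶠ q : ℝ × ℝ in 𝓝 (β₀, β₀),
      (ρ q.1 * sin q.1) * (ρ q.2 * sin q.2) < L ^ 2 * r ^ 2 := by
    refine hc.eventually_lt_const ?_
    rw [hval]; nlinarith [pow_pos hrpos 2]
  have h2 : ∀ᶠ q : ℝ × ℝ in 𝓝 (β₀, β₀),
      (L ^ 2)⁻¹ * r ^ 2 < (ρ q.1 * sin q.1) * (ρ q.2 * sin q.2) := by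
    refine hc.eventually_const_lt ?_
    rw [hval]; nlinarith [pow_pos hrpos 2, inv_lt_one_of_one_lt₀ hL2]
  have hall := (eventually_meridian_chord hρ hpos β₀ hL).and (h1.and h2)
  rw [nhds_prod_eq] at hall
  obtain ⟨U, hU, hUU⟩ := Filter.mem_prod_self_iff.mp hall
  obtain ⟨V, hVU, hVo, hβV⟩ := _root_.mem_nhds_iff.mp (Filter.inter_mem hU (isOpen_Ioo.mem_nhds hβ₀))
  refine ⟨V, hVo, hβV, fun x hx => (hVU hx).2, ?_⟩
  rintro ⟨a, ω₁⟩ ⟨ha, h₁⟩ ⟨b, ω₂⟩ ⟨hb, h₂⟩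
  simp only at ha h₁ hb h₂
  obtain ⟨⟨g1, g2⟩, g3, g4⟩ := hUU (mk_mem_prod (hVU ha).1 (hVU hb).1)
  simp only at g1 g2 g3 g4
  have hX : dist (revPoint c e ρ (a, ω₁)) (revPoint c e ρ (b, ω₂)) ^ 2 =
      (ρ a * sin a - ρ b * sin b) ^ 2 + (-(ρ a * cos a) - -(ρ b * cos b)) ^ 2
        + ρ a * sin a * (ρ b * sin b) * ‖ω₁ - ω₂‖ ^ 2 := by
    rw [revPoint_eq, revPoint_eq, dist_add_left, dist_eq_norm]
    exact dist_sq_cylPoint he h₁ h₂ _ _ _ _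
  have hY : dist (cylPoint e (v / r * a, ω₁)) (cylPoint e (v / r * b, ω₂)) ^ 2 =
      (1 - 1) ^ 2 + (v / r * a - v / r * b) ^ 2 + 1 * 1 * ‖ω₁ - ω₂‖ ^ 2 := by
    rw [dist_eq_norm]
    have := dist_sq_cylPoint he h₁ h₂ 1 1 (v / r * a) (v / r * b)
    rw [one_smul, one_smul] at this
    exact this
  have hY' : r ^ 2 * dist (cylPoint e (v / r * a, ω₁)) (cylPoint e (v / r * b, ω₂)) ^ 2
      = v ^ 2 * (a - b) ^ 2 + r ^ 2 * ‖ω₁ - ω₂‖ ^ 2 := by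
    rw [hY]; field_simp; ring
  have hω := sq_nonneg ‖ω₁ - ω₂‖
  have g4' : r ^ 2 ≤ L ^ 2 * (ρ a * sin a * (ρ b * sin b)) := by
    rw [inv_mul_eq_div, div_lt_iff₀ (by positivity)] at g4
    linarith
  constructor
  · refine abs_le_of_sq_le_sq' ?_ (by positivity) |>.2
    rw [mul_pow, mul_pow, mul_assoc, hY', hX]
    nlinarith [mul_le_mul_of_nonneg_right g3.le hω]
  · refine abs_le_of_sq_le_sq' ?_ (by positivity) |>.2
    rw [mul_pow, mul_pow L, hY', hX]
    nlinarith [mul_le_mul_of_nonneg_right g4' hω]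

end Revolution

section Revolution

variable {E : Type*} [NormedAddCommGroup E] [InnerProductSpace ℝ E] 

theorem inner_cylPoint {e : E} (he : ‖e‖ = 1) {p : ℝ × E} (hp : p.2 ∈ equator e) :
    inner ℝ e (cylPoint e p) = p.1 := by
  simp [cylPoint, inner_add_right, inner_smul_right, hp.2, he]

theorem revPoint_sub_norm {c e : E} (he : ‖e‖ = 1) {ρ : ℝ → ℝ} (hpos : ∀ β, 0 < ρ β)
    {p : ℝ × E} (hp : p.2 ∈ equator e) : ‖revPoint c e ρ p - c‖ = ρ p.1 := by
  have h0 : inner ℝ p.2 e = 0 := by rw [real_inner_comm]; exact hp.2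
  have : ‖sin p.1 • p.2 - cos p.1 • e‖ ^ 2 = 1 := by
    rw [norm_sub_sq_real, norm_smul, norm_smul, hp.1, he, inner_smul_left, inner_smul_right, h0]
    simp
  have h1 : ‖sin p.1 • p.2 - cos p.1 • e‖ = 1 :=
    (pow_eq_one_iff_of_nonneg (norm_nonneg _) two_ne_zero).mp this
  rw [revPoint, add_sub_cancel_left, norm_smul, h1, mul_one, Real.norm_eq_abs, abs_of_pos (hpos _)]

/-- The polar angle of `x` seen from `c`, measured from `-e`. -/
def polarAngle (c e x : E) : ℝ := arccos (-(inner ℝ e (x - c) / ‖x - c‖))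

theorem polarAngle_revPoint {c e : E} (he : ‖e‖ = 1) {ρ : ℝ → ℝ} (hpos : ∀ β, 0 < ρ β)
    {p : ℝ × E} (hp : p.2 ∈ equator e) (hβ : p.1 ∈ Icc 0 π) :
    polarAngle c e (revPoint c e ρ p) = p.1 := by
  have := (hpos p.1).ne'
  rw [polarAngle, revPoint_sub_norm he hpos hp, revPoint, add_sub_cancel_left, inner_smul_right,
    inner_sub_right, inner_smul_right, inner_smul_right, hp.2, real_inner_self_eq_norm_sq, he]
  rw [mul_div_cancel_left₀ _ this]
  simpa using arccos_cos hβ.1 hβ.2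

variable [MeasurableSpace E] [BorelSpace E]

theorem exists_cylinder_const {e : E} (he : ‖e‖ = 1) {d : ℝ} (hd : 0 ≤ d)
    (hfin : μH[d] (sphere (0 : E) 1) ≠ ∞) :
    ∃ κ : ℝ≥0, ∀ B : Set ℝ, MeasurableSet B →
      μH[d] (cylPoint e '' (B ×ˢ equator e)) = κ * volume B := by
  let Cyl : Set E := cylPoint e '' (univ ×ˢ equator e)
  have hmeas : Measurable (fun x : E => inner ℝ e x) := by fun_prop
  let lam : Measure ℝ := (μH[d].restrict Cyl).map (fun x : E => inner ℝ e x)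
  have hlam : ∀ B : Set ℝ, MeasurableSet B → lam B = μH[d] (cylPoint e '' (B ×ˢ equator e)) := by
    intro B hB
    rw [Measure.map_apply hmeas hB, Measure.restrict_apply (hmeas hB)]
    congr 1
    ext x
    constructor
    · rintro ⟨hx, p, hp, rfl⟩
      refine ⟨p, ⟨?_, hp.2⟩, rfl⟩
      rwa [mem_preimage, inner_cylPoint he hp.2] at hx
    · rintro ⟨p, hp, rfl⟩
      refine ⟨?_, p, ⟨mem_univ _, hp.2⟩, rfl⟩
      rw [mem_preimage, inner_cylPoint he hp.2]
      exact hp.1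
  have hinv : lam.IsAddLeftInvariant := by
    refine (forall_measure_preimage_add_iff lam).mp fun t B hB => ?_
    rw [hlam _ hB, hlam _ (measurable_const_add t hB)]
    rw [← (IsometryEquiv.addRight (t • e)).hausdorffMeasure_image]
    congr 1
    ext x
    simp only [mem_image, mem_prod, mem_preimage, Prod.exists, cylPoint]
    constructor
    · rintro ⟨_, ⟨z, ω, ⟨hz, hω⟩, rfl⟩, rfl⟩
      refine ⟨t + z, ω, ⟨hz, hω⟩, ?_⟩
      simp only [IsometryEquiv.addRight_apply]
      module
    · rintro ⟨z, ω, ⟨hz, hω⟩, rfl⟩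
      refine ⟨_, ⟨z - t, ω, ⟨by simpa using hz, hω⟩, rfl⟩, ?_⟩
      simp only [IsometryEquiv.addRight_apply]
      module
  have hcomp : IsFiniteMeasureOnCompacts lam := by
    obtain ⟨V, hVo, hβV, hV, hVV⟩ := exists_open_revPoint_bilipschitz (c := (0 : E)) he
      (ρ := fun _ => 1) contDiff_const (fun _ => one_pos) (β₀ := π / 2)
      ⟨by positivity, by linarith [pi_pos]⟩ (L := 2) (by norm_num)
    have hone : meridianSpeed (fun _ => 1) (π / 2) = 1 := by
      simp [meridianSpeed]
    simp only [hone, one_mul, sin_pi_div_two, div_one] at hVV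
    refine ⟨fun K hK => ?_⟩
    refine measure_lt_top_of_isCompact_of_isAddLeftInvariant V hVo ⟨_, hβV⟩ ?_ hK
    rw [hlam _ hVo.measurableSet]
    refine ne_top_of_le_ne_top ?_ (hausdorffMeasure_image_le_of_dist_le (cylPoint e)
      (revPoint (0 : E) e fun _ => 1) (V ×ˢ equator e) 2 hd fun p hp q hq => (hVV p hp q hq).2)
    refine ENNReal.mul_ne_top (ENNReal.rpow_ne_top_of_nonneg hd (by simp)) ?_
    refine ne_top_of_le_ne_top hfin (measure_mono ?_)
    rintro _ ⟨p, hp, rfl⟩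
    have := revPoint_sub_norm (c := (0 : E)) he (ρ := fun _ => 1) (fun _ => one_pos) hp.2
    simpa using this
  refine ⟨Measure.addHaarScalarFactor lam volume, fun B hB => ?_⟩
  rw [← hlam B hB]
  exact congrArg (fun μ' : Measure ℝ => μ' B) (Measure.isAddLeftInvariant_eq_smul lam volume)

/-- The radius-weighted density of the surface measure of a surface of revolution. -/
def revDensity (m : ℕ) (ρ : ℝ → ℝ) (β : ℝ) : ℝ := (ρ β * sin β) ^ m * meridianSpeed ρ β

theorem continuous_revDensity (m : ℕ) {ρ : ℝ → ℝ} (hρ : ContDiff ℝ 1 ρ) :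
    Continuous (revDensity m ρ) := by
  have := hρ.continuous
  have := continuous_meridianSpeed hρ
  unfold revDensity
  fun_prop

theorem revDensity_pos (m : ℕ) {ρ : ℝ → ℝ} (hpos : ∀ β, 0 < ρ β) {β : ℝ} (hβ : β ∈ Ioo 0 π) :
    0 < revDensity m ρ β :=
  mul_pos (pow_pos (mul_pos (hpos _) (sin_pos_of_mem_Ioo hβ)) _) (meridianSpeed_pos hpos _)

open scoped Pointwise in
theorem exists_open_measure_revPoint_compare {e : E} (he : ‖e‖ = 1) {m : ℕ} {κ : ℝ≥0}
    (hκ : ∀ B : Set ℝ, MeasurableSet B →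
      μH[(m : ℝ) + 1] (cylPoint e '' (B ×ˢ equator e)) = κ * volume B)
    (c : E) {ρ : ℝ → ℝ} (hρ : ContDiff ℝ 1 ρ) (hpos : ∀ β, 0 < ρ β) {β₀ : ℝ}
    (hβ₀ : β₀ ∈ Ioo 0 π) {L : ℝ≥0} (hL : 1 < L) :
    ∃ V : Set ℝ, IsOpen V ∧ β₀ ∈ V ∧ ∀ B ⊆ V, MeasurableSet B →
      μH[(m : ℝ) + 1] (revPoint c e ρ '' (B ×ˢ equator e)) ≤
        (L : ℝ≥0∞) ^ (m + 2) * (κ * ∫⁻ β in B, ENNReal.ofReal (revDensity m ρ β)) ∧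
      (κ * ∫⁻ β in B, ENNReal.ofReal (revDensity m ρ β)) ≤
        (L : ℝ≥0∞) ^ (m + 2) * μH[(m : ℝ) + 1] (revPoint c e ρ '' (B ×ˢ equator e)) := by
  have hd : (0 : ℝ) ≤ (m : ℝ) + 1 := by positivity
  have hLr : (1 : ℝ) < L := by exact_mod_cast hL
  obtain ⟨V, hVo, hβV, hV, hVV⟩ := exists_open_revPoint_bilipschitz (c := c) he hρ hpos hβ₀ hLr
  set r := ρ β₀ * sin β₀ with hr
  have hrpos : 0 < r := mul_pos (hpos _) (sin_pos_of_mem_Ioo hβ₀)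
  set v := meridianSpeed ρ β₀ with hv
  have hvpos : 0 < v := meridianSpeed_pos hpos β₀
  set g := revDensity m ρ with hg
  have hgc : Continuous g := continuous_revDensity m hρ
  have hg0 : g β₀ = r ^ m * v := rfl
  have hg0pos : 0 < g β₀ := revDensity_pos m hpos hβ₀
  have hW : ∀ᶠ β in 𝓝 β₀, g β < L * g β₀ ∧ g β₀ < L * g β := by
    refine (hgc.continuousAt.eventually_lt_const (by nlinarith)).and ?_
    exact (hgc.const_mul _).continuousAt.eventually_const_lt (by nlinarith)
  obtain ⟨W, hWg, hWo, hβW⟩ := _root_.mem_nhds_iff.mp hW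
  refine ⟨V ∩ W, hVo.inter hWo, ⟨hβV, hβW⟩, fun B hB hBm => ?_⟩
  have hkpos : 0 < v / r := div_pos hvpos hrpos
  have hcyl : μH[(m : ℝ) + 1] ((fun p : ℝ × E => cylPoint e (v / r * p.1, p.2)) ''
      (B ×ˢ equator e)) = κ * (ENNReal.ofReal (v / r) * volume B) := by
    have h1 : (fun p : ℝ × E => cylPoint e (v / r * p.1, p.2)) '' (B ×ˢ equator e)
        = cylPoint e '' ((((v / r) • B) : Set ℝ) ×ˢ equator e) := by
      ext x
      simp only [mem_image, mem_prod, Prod.exists, mem_smul_set]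
      constructor
      · rintro ⟨z, ω, ⟨hz, hω⟩, rfl⟩
        exact ⟨_, ω, ⟨⟨z, hz, rfl⟩, hω⟩, rfl⟩
      · rintro ⟨_, ω, ⟨⟨z, hz, rfl⟩, hω⟩, rfl⟩
        exact ⟨z, ω, ⟨hz, hω⟩, rfl⟩
    rw [h1, hκ _ (hBm.const_smul_of_ne_zero hkpos.ne'), Measure.addHaar_smul]
    simp [abs_of_pos hkpos]
  have hpow : ∀ x : ℝ≥0∞, x ^ ((m : ℝ) + 1) = x ^ (m + 1) := fun x => by
    rw [← ENNReal.rpow_natCast]; push_cast; rfl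
  have hrv : ENNReal.ofReal r ^ (m + 1) * (κ * (ENNReal.ofReal (v / r) * volume B))
      = κ * (ENNReal.ofReal (g β₀) * volume B) := by
    have : ENNReal.ofReal r ^ (m + 1) * ENNReal.ofReal (v / r) = ENNReal.ofReal (g β₀) := by
      rw [← ENNReal.ofReal_pow hrpos.le, ← ENNReal.ofReal_mul (by positivity), hg0]
      congr 1
      rw [pow_succ]
      field_simp
    rw [← this]; ring
  have hT : B ×ˢ equator e ⊆ V ×ˢ equator e :=
    prod_mono (hB.trans inter_subset_left) le_rfl
  have hgB : ENNReal.ofReal (g β₀) * volume B ≤ L * ∫⁻ β in B, ENNReal.ofReal (g β) := by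
    rw [← lintegral_const_mul _ (by fun_prop), ← setLIntegral_const]
    refine setLIntegral_mono (by fun_prop) fun β hβ => ?_
    have : (L : ℝ≥0∞) = ENNReal.ofReal L := by simp
    rw [this, ← ENNReal.ofReal_mul (by positivity)]
    exact ENNReal.ofReal_le_ofReal (hWg (hB hβ).2).2.le
  have hgB' : ∫⁻ β in B, ENNReal.ofReal (g β) ≤ L * (ENNReal.ofReal (g β₀) * volume B) := by
    rw [← mul_assoc, ← setLIntegral_const]
    refine setLIntegral_mono (by fun_prop) fun β hβ => ?_
    have : (L : ℝ≥0∞) = ENNReal.ofReal L := by simp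
    rw [this, ← ENNReal.ofReal_mul (by positivity)]
    exact ENNReal.ofReal_le_ofReal (hWg (hB hβ).2).1.le
  constructor
  · calc μH[(m : ℝ) + 1] (revPoint c e ρ '' (B ×ˢ equator e))
        ≤ ((L * r.toNNReal : ℝ≥0) : ℝ≥0∞) ^ ((m : ℝ) + 1) *
          (κ * (ENNReal.ofReal (v / r) * volume B)) := by
          rw [← hcyl]
          refine hausdorffMeasure_image_le_of_dist_le _ _ _ _ hd fun p hp q hq => ?_
          simpa [Real.coe_toNNReal _ hrpos.le] using (hVV p (hT hp) q (hT hq)).1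
      _ = L ^ (m + 1) * (κ * (ENNReal.ofReal (g β₀) * volume B)) := by
          rw [hpow, ← hrv, ENNReal.coe_mul, mul_pow, mul_assoc]; rfl
      _ ≤ L ^ (m + 1) * (κ * (L * ∫⁻ β in B, ENNReal.ofReal (g β))) := by gcongr
      _ = _ := by ring
  · calc κ * ∫⁻ β in B, ENNReal.ofReal (g β)
        ≤ κ * (L * (ENNReal.ofReal (g β₀) * volume B)) := by gcongr
      _ = L * (ENNReal.ofReal r ^ (m + 1) * (κ * (ENNReal.ofReal (v / r) * volume B))) := by
          rw [hrv]; ring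
      _ ≤ L * (ENNReal.ofReal r ^ (m + 1) * (((L / r.toNNReal : ℝ≥0) : ℝ≥0∞) ^ ((m : ℝ) + 1) *
          μH[(m : ℝ) + 1] (revPoint c e ρ '' (B ×ˢ equator e)))) := by
          rw [← hcyl]
          gcongr
          refine hausdorffMeasure_image_le_of_dist_le _ _ _ _ hd fun p hp q hq => ?_
          have := (hVV p (hT hp) q (hT hq)).2
          rw [NNReal.coe_div, Real.coe_toNNReal _ hrpos.le, div_mul_eq_mul_div (L : ℝ),
            le_div_iff₀ hrpos]
          linarith
      _ = _ := by
          have h1 : ENNReal.ofReal r ^ (m + 1) * ((L / r.toNNReal : ℝ≥0) : ℝ≥0∞) ^ (m + 1)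
              = L ^ (m + 1) := by
            rw [← mul_pow]
            congr 1
            change ((r.toNNReal : ℝ≥0) : ℝ≥0∞) * _ = _
            rw [← ENNReal.coe_mul, mul_div_cancel₀]
            simpa using hrpos
          rw [hpow, ← mul_assoc (ENNReal.ofReal r ^ (m + 1)), h1]; ring

theorem hausdorffMeasure_revPoint_image {e : E} (he : ‖e‖ = 1) {m : ℕ} {κ : ℝ≥0}
    (hκ : ∀ B : Set ℝ, MeasurableSet B →
      μH[(m : ℝ) + 1] (cylPoint e '' (B ×ˢ equator e)) = κ * volume B)
    (c : E) {ρ : ℝ → ℝ} (hρ : ContDiff ℝ 1 ρ) (hpos : ∀ β, 0 < ρ β) (η : Measure ℝ)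
    (hη : ∀ B ⊆ Ioo 0 π, MeasurableSet B →
      η B = μH[(m : ℝ) + 1] (revPoint c e ρ '' (B ×ˢ equator e))) :
    η.restrict (Ioo 0 π) = 
      κ • (volume.restrict (Ioo 0 π)).withDensity (fun β => ENNReal.ofReal (revDensity m ρ β)) := by
  have hgm : Measurable (fun β => ENNReal.ofReal (revDensity m ρ β)) :=
    (continuous_revDensity m hρ).measurable.ennreal_ofReal
  set ν : Measure ℝ := κ • volume.withDensity (fun β => ENNReal.ofReal (revDensity m ρ β)) with hν
  have hνB : ∀ B, MeasurableSet B →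
      ν B = κ * ∫⁻ β in B, ENNReal.ofReal (revDensity m ρ β) := fun B hB => by
    rw [hν, Measure.smul_apply, withDensity_apply _ hB]; rfl
  have key : ∀ B ⊆ Ioo 0 π, MeasurableSet B → ∀ L : ℝ≥0, 1 < L →
      η B ≤ (L : ℝ≥0∞) ^ (m + 2) * ν B ∧ ν B ≤ (L : ℝ≥0∞) ^ (m + 2) * η B := by
    intro B hB hBm L hL
    constructor
    · refine measure_le_of_locally_le (ν := ((L : ℝ≥0∞) ^ (m + 2)) • ν) (s := Ioo 0 π)
        (fun β hβ => ?_) hBm hB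
      obtain ⟨V, hVo, hβV, hV⟩ := exists_open_measure_revPoint_compare he hκ c hρ hpos hβ hL
      refine ⟨V ∩ Ioo 0 π, hVo.inter isOpen_Ioo, ⟨hβV, hβ⟩, fun C hC hCm => ?_⟩
      rw [hη C (hC.trans inter_subset_right) hCm, Measure.smul_apply, hνB C hCm]
      exact (hV C (hC.trans inter_subset_left) hCm).1
    · refine measure_le_of_locally_le (ν := ((L : ℝ≥0∞) ^ (m + 2)) • η) (s := Ioo 0 π)
        (fun β hβ => ?_) hBm hB
      obtain ⟨V, hVo, hβV, hV⟩ := exists_open_measure_revPoint_compare he hκ c hρ hpos hβ hL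
      refine ⟨V ∩ Ioo 0 π, hVo.inter isOpen_Ioo, ⟨hβV, hβ⟩, fun C hC hCm => ?_⟩
      rw [hνB C hCm, Measure.smul_apply, hη C (hC.trans inter_subset_right) hCm]
      exact (hV C (hC.trans inter_subset_left) hCm).2
  have lim : ∀ x y : ℝ≥0∞, (∀ L : ℝ≥0, 1 < L → x ≤ (L : ℝ≥0∞) ^ (m + 2) * y) → x ≤ y := by
    intro x y h
    have hc : Filter.Tendsto (fun L : ℝ≥0 => (L : ℝ≥0∞) ^ (m + 2) * y) (𝓝[>] 1) (𝓝 (1 * y)) := by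
      refine ENNReal.Tendsto.mul_const ?_ (Or.inl one_ne_zero)
      have h1 : Filter.Tendsto (fun L : ℝ≥0 => ((L ^ (m + 2) : ℝ≥0) : ℝ≥0∞)) (𝓝 1)
          (𝓝 ((1 ^ (m + 2) : ℝ≥0) : ℝ≥0∞)) :=
        ENNReal.tendsto_coe.mpr ((continuous_pow (m + 2)).tendsto 1)
      simp only [ENNReal.coe_pow, one_pow, ENNReal.coe_one] at h1
      exact h1.mono_left nhdsWithin_le_nhds
    rw [one_mul] at hc
    exact ge_of_tendsto hc (Filter.eventually_of_mem self_mem_nhdsWithin fun L hL => h L hL)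
  have heq : ∀ B ⊆ Ioo 0 π, MeasurableSet B → η B = ν B := fun B hB hBm =>
    le_antisymm (lim _ _ fun L hL => (key B hB hBm L hL).1) (lim _ _ fun L hL => (key B hB hBm L hL).2)
  have : κ • (volume.restrict (Ioo 0 π)).withDensity (fun β => ENNReal.ofReal (revDensity m ρ β))
      = ν.restrict (Ioo 0 π) := by
    rw [hν, Measure.restrict_smul, restrict_withDensity measurableSet_Ioo]
  rw [this]
  ext B hB
  rw [Measure.restrict_apply hB, Measure.restrict_apply hB]
  exact heq _ inter_subset_right (hB.inter measurableSet_Ioo)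

theorem integral_revPoint_image {e : E} (he : ‖e‖ = 1) {m : ℕ} {κ : ℝ≥0}
    (hκ : ∀ B : Set ℝ, MeasurableSet B →
      μH[(m : ℝ) + 1] (cylPoint e '' (B ×ˢ equator e)) = κ * volume B)
    (c : E) {ρ : ℝ → ℝ} (hρ : ContDiff ℝ 1 ρ) (hpos : ∀ β, 0 < ρ β)
    (hS : MeasurableSet (revPoint c e ρ '' (Icc 0 π ×ˢ equator e)))
    {f : E → ℝ} {h : ℝ → ℝ} (hh : Measurable h)
    (hfh : ∀ p ∈ Ioo 0 π ×ˢ equator e, f (revPoint c e ρ p) = h p.1) :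
    ∫ x in revPoint c e ρ '' (Icc 0 π ×ˢ equator e), f x ∂μH[(m : ℝ) + 1]
      = κ * ∫ β in (0 : ℝ)..π, h β * revDensity m ρ β := by
  set A := revPoint c e ρ '' (Icc 0 π ×ˢ equator e) with hA
  have hmeas : Measurable (polarAngle c e) := by
    unfold polarAngle
    fun_prop
  set η : Measure ℝ := (μH[(m : ℝ) + 1].restrict A).map (polarAngle c e) with hηdef
  have hη : ∀ B ⊆ Icc 0 π, MeasurableSet B →
      η B = μH[(m : ℝ) + 1] (revPoint c e ρ '' (B ×ˢ equator e)) := by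
    intro B hB hBm
    rw [hηdef, Measure.map_apply hmeas hBm, Measure.restrict_apply (hmeas hBm)]
    congr 1
    ext x
    constructor
    · rintro ⟨hx, p, hp, rfl⟩
      rw [mem_preimage, polarAngle_revPoint he hpos hp.2 hp.1] at hx
      exact ⟨p, ⟨hx, hp.2⟩, rfl⟩
    · rintro ⟨p, hp, rfl⟩
      refine ⟨?_, p, ⟨hB hp.1, hp.2⟩, rfl⟩
      rw [mem_preimage, polarAngle_revPoint he hpos hp.2 (hB hp.1)]
      exact hp.1
  have hpole : ∀ β ∈ Icc 0 π, sin β = 0 → η {β} = 0 := by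
    intro β hβ hs
    rw [hη _ (by simpa using hβ) (measurableSet_singleton β)]
    have := Measure.nullSingletonClass_hausdorff E (d := (m : ℝ) + 1) (by positivity)
    refine measure_mono_null (t := {c + ρ β • (-(cos β • e))}) ?_ (measure_singleton _)
    rintro _ ⟨⟨b, ω⟩, ⟨hb, hω⟩, rfl⟩
    simp only [mem_singleton_iff] at hb
    subst hb
    simp [revPoint, hs]
  have hae : ∀ᵐ β ∂η, β ∈ Ioo 0 π := by
    have h1 : ∀ᵐ β ∂η, β ∈ Icc 0 π := by
      rw [hηdef]
      refine (ae_map_iff hmeas.aemeasurable measurableSet_Icc).mpr ?_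
      exact Filter.Eventually.of_forall fun x => ⟨arccos_nonneg _, arccos_le_pi _⟩
    have h2 : ∀ᵐ β ∂η, β ≠ 0 := by
      have := hpole 0 ⟨le_rfl, pi_pos.le⟩ sin_zero
      exact compl_mem_ae_iff.mpr this
    have h3 : ∀ᵐ β ∂η, β ≠ π := by
      have := hpole π ⟨pi_pos.le, le_rfl⟩ sin_pi
      exact compl_mem_ae_iff.mpr this
    filter_upwards [h1, h2, h3] with β a b c
    exact ⟨lt_of_le_of_ne a.1 b.symm, lt_of_le_of_ne a.2 c⟩
  have hηr : η.restrict (Ioo 0 π) = η := Measure.restrict_eq_self_of_ae_mem hae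
  have hform := hausdorffMeasure_revPoint_image he hκ c hρ hpos η
    fun B hB hBm => hη B (hB.trans Ioo_subset_Icc_self) hBm
  rw [hηr] at hform
  have hfae : ∀ᵐ x ∂(μH[(m : ℝ) + 1].restrict A), f x = h (polarAngle c e x) := by
    filter_upwards [ae_of_ae_map hmeas.aemeasurable hae, ae_restrict_mem hS] with x hx hxA
    obtain ⟨p, hp, rfl⟩ := hxA
    rw [polarAngle_revPoint he hpos hp.2 hp.1] at hx ⊢
    exact hfh p ⟨hx, hp.2⟩
  rw [integral_congr_ae hfae, ← integral_map hmeas.aemeasurable hh.aestronglyMeasurable,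
    ← hηdef, hform, integral_smul_nnreal_measure, integral_withDensity_eq_integral_toReal_smul
      ((continuous_revDensity m hρ).measurable.ennreal_ofReal) (by simp),
    intervalIntegral.integral_of_le pi_pos.le, integral_Ioc_eq_integral_Ioo]
  rw [NNReal.smul_def, smul_eq_mul]
  congr 1
  refine setIntegral_congr_fun measurableSet_Ioo fun β hβ => ?_
  simp only [smul_eq_mul]
  rw [ENNReal.toReal_ofReal (revDensity_pos m hpos hβ).le, mul_comm]

end Revolution

section Meridian

/-- A cut-off with values in `[0, 1]` on `[-1/4, π + 1/4]`, equal to one on `[0, π]`. -/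
def angleCutoff (θ : ℝ) : ℝ := 1 + 4 * min θ 0 + 4 * min (π - θ) 0

/-- The primitive of `angleCutoff` vanishing at the origin. -/
def anglePrimitive (θ : ℝ) : ℝ := θ + 2 * min θ 0 ^ 2 - 2 * min (π - θ) 0 ^ 2

theorem hasDerivAt_min_zero_sq (x : ℝ) : HasDerivAt (fun y : ℝ => min y 0 ^ 2) (2 * min x 0) x := by
  rcases lt_trichotomy x 0 with h | h | h
  · have h1 : (fun y : ℝ => min y 0 ^ 2) =ᶠ[𝓝 x] fun y => y ^ 2 := by
      filter_upwards [gt_mem_nhds h] with y hy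
      rw [min_eq_left hy.le]
    rw [min_eq_left h.le]
    simpa using (hasDerivAt_pow 2 x).congr_of_eventuallyEq h1
  · subst h
    have : (fun y : ℝ => min y 0 ^ 2) =o[𝓝 0] fun y : ℝ => y := by
      have h2 : (fun y : ℝ => y ^ 2) =o[𝓝 0] fun y : ℝ => y := by
        simpa using Asymptotics.isLittleO_pow_id (𝕜 := ℝ) (n := 2) (by norm_num)
      refine Asymptotics.IsBigO.trans_isLittleO (Asymptotics.IsBigO.of_bound 1 ?_) h2
      filter_upwards with y
      rw [one_mul, norm_pow, norm_pow]
      refine pow_le_pow_left₀ (norm_nonneg _) ?_ 2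
      rcases le_total y 0 with h | h <;> simp [h]
    rw [hasDerivAt_iff_isLittleO]
    simpa using this
  · have h1 : (fun y : ℝ => min y 0 ^ 2) =ᶠ[𝓝 x] fun _ => 0 := by
      filter_upwards [lt_mem_nhds h] with y hy
      rw [min_eq_right hy.le]; simp
    rw [min_eq_right h.le]
    simpa using (hasDerivAt_const x (0 : ℝ)).congr_of_eventuallyEq h1

theorem hasDerivAt_anglePrimitive (θ : ℝ) : HasDerivAt anglePrimitive (angleCutoff θ) θ := by
  have h1 := (hasDerivAt_min_zero_sq θ).const_mul 2
  have h2 := ((hasDerivAt_min_zero_sq (π - θ)).comp θ ((hasDerivAt_id θ).const_sub π)).const_mul 2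
  have := ((hasDerivAt_id θ).add h1).sub h2
  refine this.congr_deriv ?_
  unfold angleCutoff
  ring

theorem continuous_angleCutoff : Continuous angleCutoff := by
  unfold angleCutoff
  fun_prop

theorem angleCutoff_mem_Icc {θ : ℝ} (hθ : θ ∈ Icc (-(1 / 4)) (π + 1 / 4)) :
    angleCutoff θ ∈ Icc 0 1 := by
  unfold angleCutoff
  have := pi_gt_three
  obtain ⟨h1, h2⟩ := hθ
  rcases le_total θ 0 with h | h <;> rcases le_total (π - θ) 0 with h' | h' <;>
    simp only [h, h', min_eq_left, min_eq_right] <;> constructor <;> linarith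

theorem sin_sub_mul_cos_le_of_mem_Icc {θ α : ℝ} (hθ : θ ∈ Icc 0 π) (hα : α ∈ Icc 0 π) :
    sin α - α * cos θ ≤ sin θ - θ * cos θ := by
  rcases lt_trichotomy α θ with h | h | h
  · obtain ⟨ξ, hξ, he⟩ := exists_hasDerivAt_eq_slope sin cos h continuousOn_sin
      fun x _ => hasDerivAt_sin x
    have : cos θ ≤ cos ξ := cos_le_cos_of_nonneg_of_le_pi (hα.1.trans hξ.1.le) hθ.2 hξ.2.le
    rw [he, le_div_iff₀ (by linarith)] at this
    linarith
  · rw [h]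
  · obtain ⟨ξ, hξ, he⟩ := exists_hasDerivAt_eq_slope sin cos h continuousOn_sin
      fun x _ => hasDerivAt_sin x
    have : cos ξ ≤ cos θ := cos_le_cos_of_nonneg_of_le_pi hθ.1 (hξ.2.le.trans hα.2) hξ.1.le
    rw [he, div_le_iff₀ (by linarith)] at this
    linarith

theorem sin_sub_mul_cos_le_of_neg {θ α : ℝ} (hθ : θ ∈ Icc (-(1 / 4)) 0) (hα : α ∈ Icc 0 π) :
    sin α - α * cos θ ≤ angleCutoff θ * sin θ - anglePrimitive θ * cos θ := by
  obtain ⟨x, rfl⟩ : ∃ x, θ = -x := ⟨-θ, by ring⟩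
  obtain ⟨h1, h2⟩ := hθ
  have hx0 : 0 ≤ x := by linarith
  have hx1 : x ≤ 1 / 4 := by linarith
  have hpi := pi_gt_three
  have hpi' := pi_lt_d2
  rw [angleCutoff, anglePrimitive, min_eq_left h2, min_eq_right (by linarith : (0:ℝ) ≤ π - -x),
    sin_neg, cos_neg]
  have s1 : sin x ≤ x := sin_le hx0
  have s2 : sin α ≤ α := sin_le hα.1
  have c1 : 1 - x ^ 2 / 2 ≤ cos x := one_sub_sq_div_two_le_cos
  have a1 : α * (1 - cos x) ≤ π * (x ^ 2 / 2) := by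
    have := cos_le_one x
    exact mul_le_mul hα.2 (by linarith) (by linarith) (by linarith)
  have a2 : (1 - 4 * x) * sin x ≤ (1 - 4 * x) * x := mul_le_mul_of_nonneg_left s1 (by linarith)
  have a3 : (x - 2 * x ^ 2) * (1 - x ^ 2 / 2) ≤ (x - 2 * x ^ 2) * cos x :=
    mul_le_mul_of_nonneg_left c1 (by nlinarith)
  have a4 : 0 ≤ x ^ 2 * (2 - π / 2 - x / 2 + x ^ 2) := by
    have := sq_nonneg x
    exact mul_nonneg this (by linarith)
  nlinarith

theorem sin_sub_mul_cos_le {θ α : ℝ} (hθ : θ ∈ Icc (-(1 / 4)) (π + 1 / 4)) (hα : α ∈ Icc 0 π) :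
    sin α - α * cos θ ≤ angleCutoff θ * sin θ - anglePrimitive θ * cos θ := by
  have hpi := pi_gt_three
  rcases le_total θ 0 with h | h
  · exact sin_sub_mul_cos_le_of_neg ⟨hθ.1, h⟩ hα
  rcases le_total θ π with h' | h'
  · have := sin_sub_mul_cos_le_of_mem_Icc ⟨h, h'⟩ hα
    rw [angleCutoff, anglePrimitive, min_eq_right h, min_eq_right (by linarith : 0 ≤ π - θ)]
    linarith
  · have := sin_sub_mul_cos_le_of_neg (θ := π - θ) (α := π - α)
      ⟨by linarith [hθ.2], by linarith⟩ ⟨by linarith [hα.2], by linarith [hα.1]⟩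
    rw [sin_pi_sub, sin_pi_sub, cos_pi_sub] at this
    have e1 : angleCutoff (π - θ) = angleCutoff θ := by
      unfold angleCutoff; rw [sub_sub_cancel]; ring
    have e2 : anglePrimitive (π - θ) = π - anglePrimitive θ := by
      unfold anglePrimitive; rw [sub_sub_cancel]; ring
    rw [e1, e2] at this
    linarith

theorem integral_pow_mul_pi_sub_arcsin {m : ℕ} (hm : 1 ≤ m) {R : ℝ} (hR : 0 < R) :
    ∫ s in (0 : ℝ)..R, m * s ^ (m - 1) * (π - 2 * arcsin (s / R))
      = R ^ m * ∫ x in (0 : ℝ)..π, sin x ^ m := by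
  obtain ⟨k, rfl⟩ : ∃ k, m = k + 1 := ⟨m - 1, by omega⟩
  rw [Nat.add_sub_cancel]
  set g : ℝ → ℝ := fun s => ((k + 1 : ℕ) : ℝ) * s ^ k * (π - 2 * arcsin (s / R)) with hg
  have hgc : Continuous g := by
    have := continuous_arcsin
    fun_prop
  have h1 := intervalIntegral.integral_comp_mul_deriv (a := 0) (b := π / 2)
    (f := fun x => R * sin x) (f' := fun x => R * cos x) (g := g)
    (fun x _ => (hasDerivAt_sin x).const_mul R) (by fun_prop) hgc
  simp only [sin_zero, mul_zero, sin_pi_div_two, mul_one] at h1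
  rw [← h1]
  have h2 : ∫ x in (0 : ℝ)..π / 2, (g ∘ fun x => R * sin x) x * (R * cos x)
      = ∫ x in (0 : ℝ)..π / 2, R ^ (k + 1) *
        ((((k + 1 : ℕ) : ℝ) * sin x ^ k * cos x) * (π - 2 * x)) := by
    refine intervalIntegral.integral_congr fun x hx => ?_
    rw [uIcc_of_le (by positivity)] at hx
    simp only [hg, Function.comp]
    rw [mul_div_cancel_left₀ _ hR.ne', arcsin_sin (by linarith [hx.1, pi_pos]) hx.2]
    ring
  rw [h2, intervalIntegral.integral_const_mul]
  congr 1
  have h3 := intervalIntegral.integral_deriv_mul_eq_sub (a := 0) (b := π / 2)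
    (u := fun x => sin x ^ (k + 1)) (u' := fun x => ((k + 1 : ℕ) : ℝ) * sin x ^ k * cos x)
    (v := fun x => π - 2 * x) (v' := fun _ => -2)
    (fun x _ => (hasDerivAt_sin x).pow (k + 1))
    (fun x _ => by simpa using ((hasDerivAt_id x).const_mul 2).const_sub π)
    (Continuous.intervalIntegrable (by fun_prop) _ _)
    (Continuous.intervalIntegrable (by fun_prop) _ _)
  rw [intervalIntegral.integral_add (Continuous.intervalIntegrable (by fun_prop) _ _)
    (Continuous.intervalIntegrable (by fun_prop) _ _), intervalIntegral.integral_mul_const] at h3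
  have h4 : ∫ x in (0 : ℝ)..π, sin x ^ (k + 1) = 2 * ∫ x in (0 : ℝ)..π / 2, sin x ^ (k + 1) := by
    rw [← intervalIntegral.integral_add_adjacent_intervals (b := π / 2)
      (Continuous.intervalIntegrable (by fun_prop) _ _)
      (Continuous.intervalIntegrable (by fun_prop) _ _)]
    have := intervalIntegral.integral_comp_sub_left (a := 0) (b := π / 2)
      (fun x => sin x ^ (k + 1)) π
    simp only [sin_pi_sub, sub_zero] at this
    rw [this]
    ring_nf
  rw [h4]
  simp at h3 ⊢
  linarith

/-- The lower bound for the total positive curvature of a meridian with arclength density `v`,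
distance to the axis `r`, and tangent angle `θ`, in terms of the maximal distance. -/
theorem exists_meridian_curvature_bound {m : ℕ} (hm : 1 ≤ m) {r v θ θ' : ℝ → ℝ}
    (hv : Continuous v) (hvpos : ∀ β, 0 < v β) (hθ' : Continuous θ')
    (hθd : ∀ β, HasDerivAt θ (θ' β) β) (hrd : ∀ β, HasDerivAt r (v β * cos (θ β)) β)
    (h0 : r 0 = 0) (hπ : r π = 0) (hr : ∀ β ∈ Ioo 0 π, 0 < r β)
    (hθ : ∀ β ∈ Icc 0 π, θ β ∈ Icc (-(1 / 4)) (π + 1 / 4)) :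
    ∃ R > 0, m * (∫ β in (0 : ℝ)..π, r β ^ m * v β) / R + R ^ m * ∫ x in (0 : ℝ)..π, sin x ^ m ≤
      ∫ β in (0 : ℝ)..π, max (θ' β * r β ^ m + m * v β * sin (θ β) * r β ^ (m - 1)) 0 := by
  have hrc : Continuous r := continuous_iff_continuousAt.mpr fun β => (hrd β).continuousAt
  have hθc : Continuous θ := continuous_iff_continuousAt.mpr fun β => (hθd β).continuousAt
  have hφc := continuous_angleCutoff
  have hΦc : Continuous anglePrimitive :=
    continuous_iff_continuousAt.mpr fun x => (hasDerivAt_anglePrimitive x).continuousAt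
  have hac := continuous_arcsin
  have hr0 : ∀ β ∈ Icc 0 π, 0 ≤ r β := fun β hβ => by
    rcases hβ.1.eq_or_lt with h | h
    · rw [← h, h0]
    rcases hβ.2.eq_or_lt with h' | h'
    · rw [h', hπ]
    · exact (hr β ⟨h, h'⟩).le
  obtain ⟨b, hb, hbmax⟩ := isCompact_Icc.exists_isMaxOn (nonempty_Icc.mpr pi_pos.le)
    hrc.continuousOn
  set R := r b with hR
  have hRpos : 0 < R := (hr (π / 2) ⟨by positivity, by linarith [pi_pos]⟩).trans_le
    (hbmax ⟨by positivity, by linarith [pi_pos]⟩)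
  refine ⟨R, hRpos, ?_⟩
  have hII : ∀ {f : ℝ → ℝ} {x y : ℝ}, Continuous f → IntervalIntegrable f volume x y :=
    fun hf => hf.intervalIntegrable _ _
  -- integration by parts
  have ibp : ∫ β in (0 : ℝ)..π, (angleCutoff (θ β) * θ' β * r β ^ m
      + anglePrimitive (θ β) * (m * r β ^ (m - 1) * (v β * cos (θ β)))) = 0 := by
    rw [intervalIntegral.integral_eq_sub_of_hasDerivAt
      (f := fun β => anglePrimitive (θ β) * r β ^ m)]
    · simp only [h0, hπ, zero_pow (by omega : m ≠ 0), mul_zero, sub_zero]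
    · intro β _
      have := ((hasDerivAt_anglePrimitive (θ β)).comp β (hθd β)).mul ((hrd β).pow m)
      exact this
    · exact hII (by fun_prop)
  have sub1 : ∫ β in (0 : ℝ)..b, m * r β ^ (m - 1) * arcsin (r β / R) * (v β * cos (θ β))
      = ∫ s in (0 : ℝ)..R, m * s ^ (m - 1) * arcsin (s / R) := by
    have := intervalIntegral.integral_comp_mul_deriv (a := 0) (b := b)
      (f := r) (f' := fun β => v β * cos (θ β)) (g := fun s => m * s ^ (m - 1) * arcsin (s / R))
      (fun x _ => hrd x) (by fun_prop) (by fun_prop)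
    rwa [h0] at this
  have sub2 : ∫ β in b..π, m * r β ^ (m - 1) * (π - arcsin (r β / R)) * (v β * cos (θ β))
      = - ∫ s in (0 : ℝ)..R, m * s ^ (m - 1) * (π - arcsin (s / R)) := by
    have := intervalIntegral.integral_comp_mul_deriv (a := b) (b := π)
      (f := r) (f' := fun β => v β * cos (θ β))
      (g := fun s => m * s ^ (m - 1) * (π - arcsin (s / R)))
      (fun x _ => hrd x) (by fun_prop) (by fun_prop)
    rw [hπ, intervalIntegral.integral_symm 0] at this
    exact this
  have hJ := integral_pow_mul_pi_sub_arcsin hm hRpos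
  have hJ' : ∫ s in (0 : ℝ)..R, m * s ^ (m - 1) * (π - 2 * arcsin (s / R))
      = (∫ s in (0 : ℝ)..R, m * s ^ (m - 1) * (π - arcsin (s / R)))
        - ∫ s in (0 : ℝ)..R, m * s ^ (m - 1) * arcsin (s / R) := by
    rw [← intervalIntegral.integral_sub (hII (by fun_prop)) (hII (by fun_prop))]
    congr 1; ext s; ring
  -- pointwise comparison on each half of the meridian
  set f : ℝ → ℝ := fun β => max (θ' β * r β ^ m + m * v β * sin (θ β) * r β ^ (m - 1)) 0 with hf
  have hfc : Continuous f := by fun_prop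
  set I : ℝ → ℝ := fun β => angleCutoff (θ β) * θ' β * r β ^ m
      + anglePrimitive (θ β) * (m * r β ^ (m - 1) * (v β * cos (θ β))) with hI
  have hIc : Continuous I := by fun_prop
  have key : ∀ β ∈ Icc 0 π, ∀ α ∈ Icc 0 π, sin α = r β / R →
      I β + (m / R * (r β ^ m * v β) - m * r β ^ (m - 1) * α * (v β * cos (θ β))) ≤ f β := by
    intro β hβ α hα hs
    have hφ := angleCutoff_mem_Icc (hθ β hβ)
    have hpt := sin_sub_mul_cos_le (hθ β hβ) hα
    have h1 : angleCutoff (θ β) * (θ' β * r β ^ m + m * v β * sin (θ β) * r β ^ (m - 1)) ≤ f β := by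
      have h2 : 0 ≤ f β := le_max_right _ _
      have h3 := mul_le_mul_of_nonneg_left (le_max_left
        (θ' β * r β ^ m + m * v β * sin (θ β) * r β ^ (m - 1)) 0) hφ.1
      have h4 := mul_le_of_le_one_left h2 hφ.2
      exact h3.trans h4
    have hw : 0 ≤ m * r β ^ (m - 1) * v β :=
      mul_nonneg (mul_nonneg (by positivity) (pow_nonneg (hr0 β hβ) _)) (hvpos β).le
    have h5 := mul_le_mul_of_nonneg_left hpt hw
    have h6 : m / R * (r β ^ m * v β) = m * r β ^ (m - 1) * v β * sin α := by
      rw [hs]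
      obtain ⟨k, rfl⟩ : ∃ k, m = k + 1 := ⟨m - 1, by omega⟩
      rw [Nat.add_sub_cancel, pow_succ]
      ring
    simp only [hI]
    nlinarith
  have hq : ∀ β ∈ Icc 0 π, r β / R ∈ Icc 0 1 := fun β hβ =>
    ⟨div_nonneg (hr0 β hβ) hRpos.le, (div_le_one hRpos).mpr (hbmax hβ)⟩
  have half1 : ∫ β in (0 : ℝ)..b, (I β + (m / R * (r β ^ m * v β)
      - m * r β ^ (m - 1) * arcsin (r β / R) * (v β * cos (θ β)))) ≤ ∫ β in (0 : ℝ)..b, f β := by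
    refine intervalIntegral.integral_mono_on hb.1 (hII (by fun_prop)) (hII hfc) fun β hβ => ?_
    have hβ' : β ∈ Icc 0 π := ⟨hβ.1, hβ.2.trans hb.2⟩
    obtain ⟨q0, q1⟩ := hq β hβ'
    exact key β hβ' _ ⟨arcsin_nonneg.mpr q0, (arcsin_le_pi_div_two _).trans (by linarith [pi_pos])⟩
      (sin_arcsin (by linarith) q1)
  have half2 : ∫ β in b..π, (I β + (m / R * (r β ^ m * v β)
      - m * r β ^ (m - 1) * (π - arcsin (r β / R)) * (v β * cos (θ β)))) ≤ ∫ β in b..π, f β := by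
    refine intervalIntegral.integral_mono_on hb.2 (hII (by fun_prop)) (hII hfc) fun β hβ => ?_
    have hβ' : β ∈ Icc 0 π := ⟨hb.1.trans hβ.1, hβ.2⟩
    obtain ⟨q0, q1⟩ := hq β hβ'
    refine key β hβ' _ ⟨?_, ?_⟩ ?_
    · linarith [arcsin_le_pi_div_two (r β / R), pi_pos]
    · linarith [arcsin_nonneg.mpr q0]
    · rw [sin_pi_sub, sin_arcsin (by linarith) q1]
  rw [intervalIntegral.integral_add (hII hIc) (hII (by fun_prop)),
    intervalIntegral.integral_sub (hII (by fun_prop)) (hII (by fun_prop)),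
    intervalIntegral.integral_const_mul, sub1] at half1
  rw [intervalIntegral.integral_add (hII hIc) (hII (by fun_prop)),
    intervalIntegral.integral_sub (hII (by fun_prop)) (hII (by fun_prop)),
    intervalIntegral.integral_const_mul, sub2] at half2
  have aI := intervalIntegral.integral_add_adjacent_intervals (μ := volume) (a := 0) (b := b)
    (c := π) (hII hIc) (hII hIc)
  have aA := intervalIntegral.integral_add_adjacent_intervals (μ := volume) (a := 0) (b := b)
    (c := π) (f := fun β => r β ^ m * v β) (hII (by fun_prop)) (hII (by fun_prop))
  have af := intervalIntegral.integral_add_adjacent_intervals (μ := volume) (a := 0) (b := b)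
    (c := π) (hII hfc) (hII hfc)
  rw [← af, ← hJ, hJ', ← aA]
  rw [ibp] at aI
  have e : m * ((∫ β in (0 : ℝ)..b, r β ^ m * v β) + ∫ β in b..π, r β ^ m * v β) / R
    = m / R * (∫ β in (0 : ℝ)..b, r β ^ m * v β) + m / R * ∫ β in b..π, r β ^ m * v β := by ring
  rw [e]
  linarith

theorem meridian_curvature_bound {m : ℕ} (hm : 1 ≤ m) {r v θ θ' : ℝ → ℝ}
    (hv : Continuous v) (hvpos : ∀ β, 0 < v β) (hθ' : Continuous θ')
    (hθd : ∀ β, HasDerivAt θ (θ' β) β) (hrd : ∀ β, HasDerivAt r (v β * cos (θ β)) β)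
    (h0 : r 0 = 0) (hπ : r π = 0) (hr : ∀ β ∈ Ioo 0 π, 0 < r β)
    (hθ : ∀ β ∈ Icc 0 π, θ β ∈ Icc (-(1 / 4)) (π + 1 / 4)) :
    (m + 1) * ((∫ β in (0 : ℝ)..π, r β ^ m * v β) ^ ((m : ℝ) / (m + 1)) *
        (∫ x in (0 : ℝ)..π, sin x ^ m) ^ (1 / ((m : ℝ) + 1))) ≤
      ∫ β in (0 : ℝ)..π, max (θ' β * r β ^ m + m * v β * sin (θ β) * r β ^ (m - 1)) 0 := by
  obtain ⟨R, hR, hB⟩ := exists_meridian_curvature_bound hm hv hvpos hθ' hθd hrd h0 hπ hr hθ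
  refine le_trans ?_ hB
  set A := ∫ β in (0 : ℝ)..π, r β ^ m * v β
  set A₀ := ∫ x in (0 : ℝ)..π, sin x ^ m
  have hrc : Continuous r := continuous_iff_continuousAt.mpr fun β => (hrd β).continuousAt
  have hr0 : ∀ β ∈ Icc 0 π, 0 ≤ r β := fun β hβ => by
    rcases hβ.1.eq_or_lt with h | h
    · rw [← h, h0]
    rcases hβ.2.eq_or_lt with h' | h'
    · rw [h', hπ]
    · exact (hr β ⟨h, h'⟩).le
  have hA : 0 ≤ A := intervalIntegral.integral_nonneg pi_pos.le fun β hβ =>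
    mul_nonneg (pow_nonneg (hr0 β hβ) _) (hvpos β).le
  have hA₀ : 0 ≤ A₀ := intervalIntegral.integral_nonneg pi_pos.le fun β hβ =>
    pow_nonneg (sin_nonneg_of_mem_Icc hβ) _
  have hm1 : (0 : ℝ) < m + 1 := by positivity
  have amgm := geom_mean_le_arith_mean2_weighted (w₁ := (m : ℝ) / (m + 1))
    (w₂ := 1 / ((m : ℝ) + 1)) (p₁ := A / R) (p₂ := R ^ m * A₀) (by positivity) (by positivity)
    (by positivity) (by positivity) (by field_simp)
  rw [div_rpow hA hR.le, mul_rpow (by positivity) hA₀, ← rpow_natCast R m, ← rpow_mul hR.le,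
    mul_one_div] at amgm
  have hRp : 0 < R ^ ((m : ℝ) / (m + 1)) := rpow_pos_of_pos hR _
  have e1 : A ^ ((m : ℝ) / (m + 1)) / R ^ ((m : ℝ) / (m + 1)) *
      (R ^ ((m : ℝ) / (m + 1)) * A₀ ^ (1 / ((m : ℝ) + 1)))
      = A ^ ((m : ℝ) / (m + 1)) * A₀ ^ (1 / ((m : ℝ) + 1)) := by
    field_simp
  rw [e1] at amgm
  calc _ ≤ (m + 1) * (m / (m + 1) * (A / R) + 1 / ((m : ℝ) + 1) * (R ^ (m : ℝ) * A₀)) :=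
        mul_le_mul_of_nonneg_left amgm hm1.le
    _ = _ := by rw [rpow_natCast]; field_simp

end Meridian

section Crossing

theorem eventually_neg_pos_of_hasDerivAt {g : ℝ → ℝ} {g' t : ℝ} (hg : HasDerivAt g g' t)
    (ht : g t = 0) (hpos : 0 < g') : ∀ᶠ h in 𝓝[>] (0 : ℝ), g (t - h) < 0 ∧ 0 < g (t + h) := by
  have h1 := (hasDerivAt_iff_isLittleO_nhds_zero.mp hg).def (half_pos hpos)
  have h2 : Filter.Tendsto (fun h : ℝ => -h) (𝓝 0) (𝓝 0) := by
    simpa using (continuous_neg (G := ℝ)).tendsto 0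
  have h3 := h2.eventually h1
  filter_upwards [nhdsWithin_le_nhds h1, nhdsWithin_le_nhds h3, self_mem_nhdsWithin] with h a b c
  rw [mem_Ioi] at c
  simp only [ht, sub_zero, smul_eq_mul, norm_neg, Real.norm_eq_abs, abs_of_pos c, abs_le] at a b
  rw [← sub_eq_add_neg] at b
  have : 0 < g' * h := mul_pos hpos c
  constructor <;> linarith [a.1, a.2, b.1, b.2]

theorem pos_of_upcrossing {g g' : ℝ → ℝ} (hg : ∀ t, HasDerivAt g (g' t) t)
    (hz : ∀ t, 0 ≤ t → g t = 0 → 0 < g' t) {a b : ℝ} (ha : 0 ≤ a) (hab : a < b) (hga : 0 ≤ g a) :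
    0 < g b := by
  have hnn : ∀ x ∈ Icc a b, 0 ≤ g x := by
    intro x hx
    have := image_le_of_deriv_right_lt_deriv_boundary (f := fun t => -g t) (f' := fun t => -g' t)
      (a := a) (b := b) (B := fun _ => 0) (B' := fun _ => 0)
      (fun t _ => (hg t).neg.continuousAt.continuousWithinAt)
      (fun t _ => (hg t).neg.hasDerivWithinAt) (by simpa using hga)
      (fun t => hasDerivAt_const t 0)
      (fun t ht h0 => by simpa using hz t (ha.trans ht.1) (by simpa using h0)) hx
    simpa using this
  rcases (hnn b ⟨hab.le, le_rfl⟩).eq_or_lt with h | h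
  · exfalso
    have h1 := eventually_neg_pos_of_hasDerivAt (hg b) h.symm (hz b (ha.trans hab.le) h.symm)
    have h2 : ∀ᶠ h in 𝓝[>] (0 : ℝ), h < b - a :=
      nhdsWithin_le_nhds (gt_mem_nhds (by linarith))
    obtain ⟨s, ⟨hs1, hs2⟩, hs3⟩ := ((h1.and h2).and self_mem_nhdsWithin).exists
    linarith [hnn (b - s) ⟨by linarith, by linarith⟩]
  · exact h

end Crossing

section Equator

variable {E : Type*} [NormedAddCommGroup E] [InnerProductSpace ℝ E]

theorem exists_polar {e : E} (he : ‖e‖ = 1) (hne : (equator e).Nonempty) (x : E) :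
    ∃ t : ℝ, 0 ≤ t ∧ ∃ β ∈ Icc 0 π, ∃ ω ∈ equator e, x = t • (sin β • ω - cos β • e) := by
  obtain ⟨ω₀, hω₀⟩ := hne
  set a := inner ℝ e x with ha
  set y := x - a • e with hy
  have hye : inner ℝ e y = 0 := by
    rw [hy, inner_sub_right, inner_smul_right, real_inner_self_eq_norm_sq, he, ha]; ring
  obtain ⟨ω, hω, hyω⟩ : ∃ ω ∈ equator e, y = ‖y‖ • ω := by
    by_cases h : y = 0
    · exact ⟨ω₀, hω₀, by simp [h]⟩
    · have hn : ‖y‖ ≠ 0 := norm_ne_zero_iff.mpr h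
      refine ⟨‖y‖⁻¹ • y, ⟨?_, ?_⟩, ?_⟩
      · rw [norm_smul, norm_inv, norm_norm, inv_mul_cancel₀ hn]
      · rw [inner_smul_right, hye, mul_zero]
      · rw [smul_smul, mul_inv_cancel₀ hn, one_smul]
  set z : ℂ := ⟨-a, ‖y‖⟩
  refine ⟨‖z‖, norm_nonneg _, z.arg, ⟨Complex.arg_nonneg_iff.mpr (norm_nonneg y), Complex.arg_le_pi z⟩,
    ω, hω, ?_⟩
  have h1 : ‖z‖ * cos z.arg = -a := Complex.norm_mul_cos_arg z
  have h2 : ‖z‖ * sin z.arg = ‖y‖ := Complex.norm_mul_sin_arg z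
  rw [smul_sub, smul_smul, smul_smul, h1, h2, ← hyω, hy]
  module

theorem norm_polar {e : E} (he : ‖e‖ = 1) {ω : E} (hω : ω ∈ equator e) (β : ℝ) :
    ‖sin β • ω - cos β • e‖ = 1 := by
  have := revPoint_sub_norm (c := (0 : E)) he (ρ := fun _ => 1) (fun _ => one_pos) (p := (β, ω)) hω
  simpa [revPoint] using this

/-- The orthogonal transformation exchanging two points of the equator. -/
theorem exists_isometry_equator {e : E} {ω₁ ω₂ : E} (h₁ : ω₁ ∈ equator e)
    (h₂ : ω₂ ∈ equator e) : ∃ R : E ≃ₗᵢ[ℝ] E, R e = e ∧ R ω₁ = ω₂ := by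
  refine ⟨(ℝ ∙ (ω₁ - ω₂))ᗮ.reflection, ?_, Submodule.reflection_sub (h₁.1.trans h₂.1.symm)⟩
  apply Submodule.reflection_mem_subspace_eq_self
  rw [Submodule.mem_orthogonal_singleton_iff_inner_left, inner_sub_right, h₁.2, h₂.2, sub_zero]

theorem sphere_eq_revPoint_image {e : E} (he : ‖e‖ = 1) (hne : (equator e).Nonempty) :
    sphere (0 : E) 1 = revPoint 0 e (fun _ => 1) '' (Icc 0 π ×ˢ equator e) := by
  ext x
  constructor
  · intro hx
    obtain ⟨t, ht, β, hβ, ω, hω, rfl⟩ := exists_polar he hne x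
    rw [mem_sphere_zero_iff_norm, norm_smul, norm_polar he hω, mul_one, Real.norm_eq_abs,
      abs_of_nonneg ht] at hx
    exact ⟨(β, ω), ⟨hβ, hω⟩, by simp [revPoint, hx]⟩
  · rintro ⟨p, hp, rfl⟩
    simpa [revPoint] using norm_polar he hp.2 p.1

end Equator

namespace SmoothBody

variable {n : ℕ} (K : SmoothBody n)

/-- Invariance of the domain under the orthogonal transformations fixing the axis `c + ℝ e`. -/
def IsAxialAbout (c e : Euc n) : Prop :=
  ∀ R : Euc n ≃ₗᵢ[ℝ] Euc n, R e = e → ∀ x, K.F (c + x) < 0 → K.F (c + R x) < 0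

theorem contDiff_gradient : ContDiff ℝ (⊤ : ℕ∞) (gradient K.F) := by
  have h1 : ContDiff ℝ (⊤ : ℕ∞) (fderiv ℝ K.F) := K.smooth.fderiv_right (by norm_num)
  exact (InnerProductSpace.toDual ℝ (Euc n)).symm.toContinuousLinearEquiv.contDiff.comp h1

theorem hasDerivAt_comp {γ : ℝ → Euc n} {γ' : Euc n} {t : ℝ} (hγ : HasDerivAt γ γ' t) :
    HasDerivAt (fun s => K.F (γ s)) (inner ℝ (gradient K.F (γ t)) γ') t := by
  have h1 := (K.smooth.differentiable (by norm_num) (γ t)).hasGradientAt.hasFDerivAt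
  have := h1.comp_hasDerivAt t hγ
  rwa [InnerProductSpace.toDual_apply_apply] at this

theorem hasDerivAt_ray (c u : Euc n) (t : ℝ) :
    HasDerivAt (fun s : ℝ => K.F (c + s • u)) (inner ℝ (gradient K.F (c + t • u)) u) t := by
  refine K.hasDerivAt_comp (γ := fun s : ℝ => c + s • u) ?_
  simpa using ((hasDerivAt_id t).smul_const u).const_add c

theorem nonpos_iff_mem_closure (x : Euc n) : K.F x ≤ 0 ↔ x ∈ closure K.body := by
  have hc : Continuous K.F := K.smooth.continuous
  constructor
  · intro h
    rcases h.lt_or_eq with h | h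
    · exact subset_closure h
    have h1 := eventually_neg_pos_of_hasDerivAt (K.hasDerivAt_ray x (gradient K.F x) 0)
      (by simpa using h)
      (by
        rw [zero_smul, add_zero, real_inner_self_eq_norm_sq]
        exact pow_pos (norm_pos_iff.mpr (K.regular x h)) 2)
    have h2 : Filter.Tendsto (fun s : ℝ => x + (0 - s) • gradient K.F x) (𝓝[>] 0) (𝓝 x) := by
      have : Continuous (fun s : ℝ => x + (0 - s) • gradient K.F x) := by fun_prop
      have := this.tendsto 0
      simp only [sub_zero, zero_smul, add_zero] at this
      exact this.mono_left nhdsWithin_le_nhds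
    exact mem_closure_of_tendsto h2 (h1.mono fun s hs => hs.1)
  · intro h
    have : closure K.body ⊆ {y | K.F y ≤ 0} :=
      closure_minimal (fun y (hy : K.F y < 0) => hy.le) (isClosed_le hc continuous_const)
    exact this h

variable {K}

theorem IsAxialAbout.lt_iff {c e : Euc n} (hK : K.IsAxialAbout c e) {R : Euc n ≃ₗᵢ[ℝ] Euc n}
    (hR : R e = e) (x : Euc n) : K.F (c + R x) < 0 ↔ K.F (c + x) < 0 := by
  refine ⟨fun h => ?_, hK R hR x⟩
  have := hK R.symm (by rw [LinearIsometryEquiv.symm_apply_eq, hR]) _ h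
  simpa using this

theorem IsAxialAbout.le_iff {c e : Euc n} (hK : K.IsAxialAbout c e) {R : Euc n ≃ₗᵢ[ℝ] Euc n}
    (hR : R e = e) (x : Euc n) : K.F (c + R x) ≤ 0 ↔ K.F (c + x) ≤ 0 := by
  let Ψ : Euc n ≃ₜ Euc n :=
    ((Homeomorph.addLeft (-c)).trans R.toHomeomorph).trans (Homeomorph.addLeft c)
  have hΨ : ∀ y, Ψ (c + y) = c + R y := fun y => by simp [Ψ]
  have hpre : Ψ ⁻¹' K.body = K.body := by
    ext y
    obtain ⟨z, rfl⟩ : ∃ z, y = c + z := ⟨y - c, by abel⟩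
    rw [mem_preimage, hΨ]
    exact hK.lt_iff hR z
  rw [K.nonpos_iff_mem_closure, K.nonpos_iff_mem_closure, ← hΨ, ← mem_preimage,
    Ψ.preimage_closure, hpre]

theorem IsAxialAbout.eq_iff {c e : Euc n} (hK : K.IsAxialAbout c e) {R : Euc n ≃ₗᵢ[ℝ] Euc n}
    (hR : R e = e) (x : Euc n) : K.F (c + R x) = 0 ↔ K.F (c + x) = 0 := by
  have h1 := hK.le_iff hR x
  have h2 := hK.lt_iff hR x
  constructor <;> intro h
  · exact le_antisymm (h1.mp h.le) (not_lt.mp fun h' => (h2.mpr h').ne h)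
  · exact le_antisymm (h1.mpr h.le) (not_lt.mp fun h' => (h2.mp h').ne h)

/-- The gradient at a boundary point is tangent to the plane through the axis. -/
theorem IsAxialAbout.inner_gradient_eq_zero {c e : Euc n} (hK : K.IsAxialAbout c e) {x w : Euc n}
    (hx : K.F (c + x) = 0) (hew : inner ℝ e w = 0) (hxw : inner ℝ x w = 0) :
    inner ℝ (gradient K.F (c + x)) w = 0 := by
  have main : ∀ w : Euc n, inner ℝ e w = 0 → inner ℝ x w = 0 →
      ¬ 0 < inner ℝ (gradient K.F (c + x)) w := by
    intro w hew hxw hpos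
    have hray := K.hasDerivAt_ray (c + x) w 0
    rw [zero_smul, add_zero] at hray
    obtain ⟨s, hs1, hs2⟩ := (eventually_neg_pos_of_hasDerivAt hray (by simpa using hx) hpos).exists
    rw [add_assoc] at hs1 hs2
    have hR : (ℝ ∙ w)ᗮ.reflection e = e := by
      apply Submodule.reflection_mem_subspace_eq_self
      rwa [Submodule.mem_orthogonal_singleton_iff_inner_left]
    have h1 : (ℝ ∙ w)ᗮ.reflection x = x := by
      apply Submodule.reflection_mem_subspace_eq_self
      rwa [Submodule.mem_orthogonal_singleton_iff_inner_left]
    have h2 := (hK.lt_iff hR (x + (0 - s) • w)).mpr hs1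
    rw [map_add, map_smul, h1, Submodule.reflection_orthogonalComplement_singleton_eq_neg] at h2
    have e1 : (0 - s) • -w = (0 + s) • w := by module
    rw [e1] at h2
    linarith
  refine le_antisymm (not_lt.mp (main w hew hxw)) ?_
  have := main (-w) (by simpa using hew) (by simpa using hxw)
  rw [inner_neg_right] at this
  linarith

end SmoothBody

section TangentAngle

/-- The angle between the tangent of the meridian of a radial graph and the equatorial direction. -/
def tangentAngle (ρ : ℝ → ℝ) (β : ℝ) : ℝ := β - arctan (deriv ρ β / ρ β)

variable {ρ : ℝ → ℝ}

theorem meridianSpeed_eq (hpos : ∀ β, 0 < ρ β) (β : ℝ) :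
    meridianSpeed ρ β = ρ β * √(1 + (deriv ρ β / ρ β) ^ 2) := by
  have h := hpos β
  have h' : ρ β ^ 2 + deriv ρ β ^ 2 = ρ β ^ 2 * (1 + (deriv ρ β / ρ β) ^ 2) := by field_simp
  rw [meridianSpeed, h', sqrt_mul (sq_nonneg _), sqrt_sq h.le]

theorem meridianSpeed_mul_cos_tangentAngle (hpos : ∀ β, 0 < ρ β) (β : ℝ) :
    meridianSpeed ρ β * cos (tangentAngle ρ β) = deriv ρ β * sin β + ρ β * cos β := by
  have h := (hpos β).ne'
  have h2 : √(1 + (deriv ρ β / ρ β) ^ 2) ≠ 0 := (sqrt_pos.mpr (by positivity)).ne'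
  rw [meridianSpeed_eq hpos, tangentAngle, cos_sub, cos_arctan, sin_arctan]
  field_simp
  ring

theorem meridianSpeed_mul_sin_tangentAngle (hpos : ∀ β, 0 < ρ β) (β : ℝ) :
    meridianSpeed ρ β * sin (tangentAngle ρ β) = ρ β * sin β - deriv ρ β * cos β := by
  have h := (hpos β).ne'
  have h2 : √(1 + (deriv ρ β / ρ β) ^ 2) ≠ 0 := (sqrt_pos.mpr (by positivity)).ne'
  rw [meridianSpeed_eq hpos, tangentAngle, sin_sub, cos_arctan, sin_arctan]
  field_simp

theorem contDiff_tangentAngle (hρ : ContDiff ℝ 2 ρ) (hpos : ∀ β, 0 < ρ β) :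
    ContDiff ℝ 1 (tangentAngle ρ) := by
  have h1 : ContDiff ℝ 1 (deriv ρ) := hρ.deriv' (n := 1)
  have h2 : ContDiff ℝ 1 ρ := hρ.of_le (by norm_num)
  have h3 : ContDiff ℝ 1 (fun β => deriv ρ β / ρ β) := h1.div h2 fun β => (hpos β).ne'
  exact contDiff_id.sub (contDiff_arctan.comp h3)

theorem hasDerivAt_mul_sin (hρ : ContDiff ℝ 1 ρ) (hpos : ∀ β, 0 < ρ β) (β : ℝ) :
    HasDerivAt (fun β => ρ β * sin β) (meridianSpeed ρ β * cos (tangentAngle ρ β)) β := by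
  rw [meridianSpeed_mul_cos_tangentAngle hpos]
  exact (hρ.differentiable one_ne_zero β).hasDerivAt.mul (hasDerivAt_sin β)

theorem hasDerivAt_neg_mul_cos (hρ : ContDiff ℝ 1 ρ) (hpos : ∀ β, 0 < ρ β) (β : ℝ) :
    HasDerivAt (fun β => -(ρ β * cos β)) (meridianSpeed ρ β * sin (tangentAngle ρ β)) β := by
  rw [meridianSpeed_mul_sin_tangentAngle hpos]
  refine ((hρ.differentiable one_ne_zero β).hasDerivAt.mul (hasDerivAt_cos β)).neg.congr_deriv ?_
  ring

theorem abs_arctan_le_of_cos_ge {q : ℝ} (h : 127 / 128 ≤ cos (arctan q)) :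
    |arctan q| ≤ 1 / 4 := by
  by_contra! hlt
  have h1 : |arctan q| ≤ π := by
    rw [abs_le]
    constructor <;> linarith [arctan_lt_pi_div_two q, neg_pi_div_two_lt_arctan q, pi_pos]
  have h2 := cos_lt_cos_of_nonneg_of_le_pi (by norm_num : (0:ℝ) ≤ 1 / 4) h1 hlt
  rw [cos_abs] at h2
  have h3 := cos_le_one_sub_mul_cos_sq (x := 1 / 4)
    (by rw [abs_of_pos (by norm_num)]; linarith [pi_gt_three])
  have h4 : 1 / 10 ≤ 1 / π ^ 2 := by
    apply one_div_le_one_div_of_le (by positivity)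
    nlinarith [pi_gt_three, pi_lt_d2]
  have h5 : 2 / π ^ 2 = 2 * (1 / π ^ 2) := by ring
  rw [h5] at h3
  linarith

end TangentAngle

theorem isInvertible_of_apply_one_ne_zero {L : ℝ →L[ℝ] ℝ} (h : L 1 ≠ 0) : L.IsInvertible := by
  refine ⟨ContinuousLinearEquiv.unitsEquivAut ℝ (Units.mk0 (L 1) h), ?_⟩
  ext
  simp

namespace SmoothBody

variable {n : ℕ} {K : SmoothBody n}

theorem IsPerturbedBall.exists_center (hK : K.IsPerturbedBall (1 / 8)) :
    ∃ c : Euc n, ∀ x ∈ K.bdry, x ≠ c ∧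
      127 / 128 * (‖gradient K.F x‖ * ‖x - c‖) ≤ inner ℝ (gradient K.F x) (x - c) := by
  obtain ⟨c, hc⟩ := hK
  refine ⟨c, fun x hx => ?_⟩
  have hG : 0 < ‖gradient K.F x‖ := norm_pos_iff.mpr (K.regular x hx)
  have hν : ‖K.normal x‖ = 1 := by
    rw [normal, norm_smul, norm_inv, norm_norm, inv_mul_cancel₀ hG.ne']
  have h := hc x hx
  have hxc : x ≠ c := by
    rintro rfl
    rw [sub_self, smul_zero, sub_zero, hν] at h
    norm_num at h
  refine ⟨hxc, ?_⟩
  have hxc' : 0 < ‖x - c‖ := norm_pos_iff.mpr (sub_ne_zero.mpr hxc)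
  have h2 : ‖‖x - c‖⁻¹ • (x - c)‖ = 1 := by
    rw [norm_smul, norm_inv, norm_norm, inv_mul_cancel₀ hxc'.ne']
  have h3 := pow_le_pow_left₀ (norm_nonneg _) h 2
  rw [norm_sub_sq_real, hν, h2, normal, inner_smul_left, inner_smul_right] at h3
  simp only [conj_trivial] at h3
  have h4 : 127 / 128 ≤ ‖gradient K.F x‖⁻¹ * (‖x - c‖⁻¹ * inner ℝ (gradient K.F x) (x - c)) := by
    linarith
  rw [← mul_assoc, ← mul_inv, inv_mul_eq_div, le_div_iff₀ (by positivity)] at h4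
  exact h4

/-- Along the rays in a suitable half-plane through the axis, the boundary is crossed outwards,
almost orthogonally. -/
theorem IsAxialAbout.ray_crossing {c₀ e w ω₀ : Euc n} (hK : K.IsAxialAbout c₀ e)
    (hew : inner ℝ e w = 0) (he : ‖e‖ = 1) (hω₀ : ω₀ ∈ equator e) (hωw : inner ℝ ω₀ w = 0)
    (hc : ∀ x ∈ K.bdry, x ≠ c₀ + w ∧
      127 / 128 * (‖gradient K.F x‖ * ‖x - (c₀ + w)‖) ≤ inner ℝ (gradient K.F x) (x - (c₀ + w)))
    {β t : ℝ} (ht : 0 ≤ t) (hF : K.F (c₀ + t • (sin β • ω₀ - cos β • e)) = 0) :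
    0 < t ∧ 127 / 128 * ‖gradient K.F (c₀ + t • (sin β • ω₀ - cos β • e))‖ ≤
      inner ℝ (gradient K.F (c₀ + t • (sin β • ω₀ - cos β • e))) (sin β • ω₀ - cos β • e) := by
  set u := sin β • ω₀ - cos β • e with hu
  have huw : inner ℝ u w = 0 := by
    rw [hu, inner_sub_left, inner_smul_left, inner_smul_left, hew, hωw]; simp
  have hun : ‖u‖ = 1 := norm_polar he hω₀ β
  obtain ⟨hne, hle⟩ := hc _ hF
  have hw := hK.inner_gradient_eq_zero hF hew (by rw [inner_smul_left, huw, mul_zero])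
  set G := gradient K.F (c₀ + t • u) with hGdef
  have hG : 0 < ‖G‖ := norm_pos_iff.mpr (K.regular _ hF)
  have e1 : c₀ + t • u - (c₀ + w) = t • u - w := by abel
  rw [e1, inner_sub_right, hw, sub_zero, inner_smul_right] at hle
  have hnorm : t ≤ ‖t • u - w‖ := by
    have : ‖t • u - w‖ ^ 2 = t ^ 2 + ‖w‖ ^ 2 := by
      rw [norm_sub_sq_real, inner_smul_left, huw, norm_smul, hun]
      simp
    nlinarith [norm_nonneg (t • u - w), sq_nonneg ‖w‖]
  have htpos : 0 < t := by
    rcases ht.eq_or_lt with h | h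
    · exfalso
      rw [← h, zero_smul, zero_sub, norm_neg, zero_mul] at hle
      rw [← h, zero_smul, add_zero] at hne
      have hwn : 0 < ‖w‖ := norm_pos_iff.mpr fun h0 => hne (by rw [h0, add_zero])
      have : 0 < 127 / 128 * (‖G‖ * ‖w‖) := by positivity
      linarith
    · exact h
  refine ⟨htpos, ?_⟩
  have h1 : 127 / 128 * (‖G‖ * t) ≤ 127 / 128 * (‖G‖ * ‖t • u - w‖) := by gcongr
  have h2 : t * (127 / 128 * ‖G‖) ≤ t * inner ℝ G u := by linarith
  exact le_of_mul_le_mul_left h2 htpos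

theorem IsAxialAbout.exists_radial {c e ω₀ : Euc n} (hK : K.IsAxialAbout c e)
    (he : ‖e‖ = 1) (hω₀ : ω₀ ∈ equator e)
    (hc : ∀ β t : ℝ, 0 ≤ t → K.F (c + t • (sin β • ω₀ - cos β • e)) = 0 → 0 < t ∧
      127 / 128 * ‖gradient K.F (c + t • (sin β • ω₀ - cos β • e))‖ ≤
      inner ℝ (gradient K.F (c + t • (sin β • ω₀ - cos β • e))) (sin β • ω₀ - cos β • e)) :
    ∃ ρ : ℝ → ℝ, ContDiff ℝ (⊤ : ℕ∞) ρ ∧ (∀ β, 0 < ρ β) ∧ ∀ ω ∈ equator e, ∀ β t : ℝ, 0 ≤ t →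
      (K.F (c + t • (sin β • ω - cos β • e)) < 0 ↔ t < ρ β) ∧
      (K.F (c + t • (sin β • ω - cos β • e)) = 0 ↔ t = ρ β) := by
  set u : ℝ → Euc n := fun β => sin β • ω₀ - cos β • e with hu
  have hrot : ∀ ω ∈ equator e, ∃ R : Euc n ≃ₗᵢ[ℝ] Euc n, R e = e ∧
      ∀ β t : ℝ, t • (sin β • ω - cos β • e) = R (t • u β) := by
    intro ω hω
    obtain ⟨R, hR, hRω⟩ := exists_isometry_equator hω₀ hω
    refine ⟨R, hR, fun β t => ?_⟩
    simp [hu, hR, hRω]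
  have hder : ∀ β t : ℝ, HasDerivAt (fun s : ℝ => K.F (c + s • u β))
      (inner ℝ (gradient K.F (c + t • u β)) (u β)) t := fun β t => K.hasDerivAt_ray c (u β) t
  have hz : ∀ β t : ℝ, 0 ≤ t → K.F (c + t • u β) = 0 →
      0 < inner ℝ (gradient K.F (c + t • u β)) (u β) := by
    intro β t ht h0
    have : 0 < ‖gradient K.F (c + t • u β)‖ := norm_pos_iff.mpr (K.regular _ h0)
    have := (hc β t ht h0).2
    simp only [hu] at *
    linarith
  have hcr : ∀ β a b : ℝ, 0 ≤ a → a < b → 0 ≤ K.F (c + a • u β) → 0 < K.F (c + b • u β) :=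
    fun β a b ha hab h => pos_of_upcrossing (hder β) (hz β) ha hab h
  have hc0 : K.F c < 0 := by
    by_contra! hcon
    obtain ⟨y, hy⟩ := K.connected.nonempty
    obtain ⟨t, ht, β, hβ, ω, hω, hyt⟩ := exists_polar he ⟨_, hω₀⟩ (y - c)
    obtain ⟨R, hR, hRu⟩ := hrot ω hω
    have hy' : K.F (c + t • u β) < 0 := by
      rw [← hK.lt_iff hR, ← hRu, ← hyt]
      simpa using hy
    rcases ht.eq_or_lt with h | h
    · rw [← h, zero_smul, add_zero] at hy'
      linarith
    · exact absurd (hcr β 0 t le_rfl h (by simpa using hcon)) hy'.not_gt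
  have hFc : Continuous K.F := K.smooth.continuous
  have hex : ∀ β : ℝ, ∃ t : ℝ, 0 < t ∧ K.F (c + t • u β) = 0 := by
    intro β
    obtain ⟨r, hr⟩ := K.bounded.subset_ball c
    have hTpos : 0 < K.F (c + max r 0 • u β) := by
      by_contra! hcon
      have := hr hcon
      rw [mem_ball, dist_eq_norm, add_sub_cancel_left, norm_smul, norm_polar he hω₀ β, mul_one,
        Real.norm_eq_abs, abs_of_nonneg (le_max_right r 0)] at this
      exact absurd (le_max_left r 0) this.not_ge
    have hcont : Continuous fun t : ℝ => K.F (c + t • u β) := by fun_prop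
    obtain ⟨t, ht, h0⟩ := intermediate_value_Icc (le_max_right r 0) hcont.continuousOn
      (show (0 : ℝ) ∈ Icc _ _ from ⟨by simpa using hc0.le, hTpos.le⟩)
    exact ⟨t, (hc β t ht.1 h0).1, h0⟩
  choose ρ hρpos hρ using hex
  have huniq : ∀ β t : ℝ, 0 ≤ t → (K.F (c + t • u β) < 0 ↔ t < ρ β) ∧
      (K.F (c + t • u β) = 0 ↔ t = ρ β) := by
    intro β t ht
    rcases lt_trichotomy t (ρ β) with h | h | h
    · have h1 : K.F (c + t • u β) < 0 := by
        by_contra! hcon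
        exact (hcr β t _ ht h hcon).ne' (hρ β)
      simp [h1, h1.ne, h, h.ne]
    · subst h; simp [hρ]
    · have h1 := hcr β _ t (hρpos β).le h (hρ β).ge
      simp [h1.not_gt, h1.ne', h.not_gt, h.ne']
  refine ⟨ρ, ?_, hρpos, ?_⟩
  · rw [contDiff_iff_contDiffAt]
    intro β₀
    set Φ : ℝ × ℝ → ℝ := fun q => K.F (c + q.2 • u q.1) with hΦ
    have hΦd : ContDiff ℝ (⊤ : ℕ∞) Φ := by
      refine K.smooth.comp ?_
      simp only [hu]
      fun_prop
    have hinv : (fderiv ℝ Φ (β₀, ρ β₀) ∘L ContinuousLinearMap.inr ℝ ℝ ℝ).IsInvertible := by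
      apply isInvertible_of_apply_one_ne_zero
      have h1 : HasDerivAt (fun t : ℝ => Φ (β₀, t)) (fderiv ℝ Φ (β₀, ρ β₀) (0, 1)) (ρ β₀) :=
        ((hΦd.differentiable (by norm_num)) (β₀, ρ β₀)).hasFDerivAt.comp_hasDerivAt (ρ β₀)
          ((hasDerivAt_const _ β₀).prodMk (hasDerivAt_id _))
      have h2 := h1.unique (hder β₀ (ρ β₀))
      simp only [ContinuousLinearMap.comp_apply, ContinuousLinearMap.inr_apply, h2]
      exact (hz β₀ _ (hρpos _).le (hρ _)).ne'
    have hn0 : ((⊤ : ℕ∞) : WithTop ℕ∞) ≠ 0 := by norm_num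
    have hcd := hΦd.contDiffAt (x := (β₀, ρ β₀))
    have h1 := hcd.contDiffAt_implicitFunction hn0 hinv
    refine h1.congr_of_eventuallyEq ?_
    have h2 := hcd.eventually_apply_implicitFunction hn0 hinv
    have h3 := hcd.implicitFunction_apply_self hn0 hinv
    have h4 : ∀ᶠ β in 𝓝 β₀, 0 < hcd.implicitFunction hn0 hinv β := by
      refine h1.continuousAt.eventually_const_lt ?_
      rw [h3]; exact hρpos β₀
    filter_upwards [h2, h4] with β hβ hβ'
    rw [show Φ (β₀, ρ β₀) = 0 from hρ β₀] at hβ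
    exact ((huniq β _ hβ'.le).2.mp hβ).symm
  · intro ω hω β t ht
    obtain ⟨R, hR, hRu⟩ := hrot ω hω
    rw [hRu, hK.lt_iff hR, hK.eq_iff hR]
    exact huniq β t ht

end SmoothBody

namespace SmoothBody

variable {n : ℕ} {K : SmoothBody n}

/-- The domain is `{c + t • u : t < ρ}` in polar coordinates around the axis through `c` in the
direction `e`. -/
structure IsRadialGraph (K : SmoothBody n) (c e : Euc n) (ρ : ℝ → ℝ) : Prop where
  axial : K.IsAxialAbout c e
  norm_axis : ‖e‖ = 1
  smooth : ContDiff ℝ (⊤ : ℕ∞) ρ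
  pos : ∀ β, 0 < ρ β
  neg_iff : ∀ ω ∈ equator e, ∀ β t : ℝ, 0 ≤ t →
    (K.F (c + t • (sin β • ω - cos β • e)) < 0 ↔ t < ρ β)
  eq_iff : ∀ ω ∈ equator e, ∀ β t : ℝ, 0 ≤ t →
    (K.F (c + t • (sin β • ω - cos β • e)) = 0 ↔ t = ρ β)

namespace IsRadialGraph

variable {c e ω : Euc n} {ρ : ℝ → ℝ}

theorem apply_revPoint (h : K.IsRadialGraph c e ρ) (hω : ω ∈ equator e) (β : ℝ) :
    K.F (revPoint c e ρ (β, ω)) = 0 :=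
  (h.eq_iff ω hω β _ (h.pos β).le).mpr rfl

theorem contDiff (h : K.IsRadialGraph c e ρ) (k : ℕ) : ContDiff ℝ k ρ :=
  h.smooth.of_le (by exact_mod_cast le_top)

theorem contDiff_one (h : K.IsRadialGraph c e ρ) : ContDiff ℝ 1 ρ := h.contDiff 1

theorem hasDerivAt_revPoint (h : K.IsRadialGraph c e ρ) (ω : Euc n) (β : ℝ) :
    HasDerivAt (fun β => revPoint c e ρ (β, ω))
      (meridianSpeed ρ β • (cos (tangentAngle ρ β) • ω + sin (tangentAngle ρ β) • e)) β := by
  simp only [revPoint_eq]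
  refine ((((hasDerivAt_mul_sin h.contDiff_one h.pos β).smul_const ω).add
    ((hasDerivAt_neg_mul_cos h.contDiff_one h.pos β).smul_const e)).const_add c).congr_deriv ?_
  module

theorem normal_revPoint (h : K.IsRadialGraph c e ρ) (hω : ω ∈ equator e) (β : ℝ) :
    K.normal (revPoint c e ρ (β, ω)) =
      sin (tangentAngle ρ β) • ω - cos (tangentAngle ρ β) • e := by
  have he := h.norm_axis
  have hF := h.apply_revPoint hω β
  have heω : inner ℝ e ω = 0 := hω.2
  have hωe : inner ℝ ω e = 0 := by rw [real_inner_comm]; exact hω.2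
  have hGne := K.regular _ hF
  have hτ : inner ℝ (gradient K.F (revPoint c e ρ (β, ω)))
      (cos (tangentAngle ρ β) • ω + sin (tangentAngle ρ β) • e) = 0 := by
    have h1 := K.hasDerivAt_comp (h.hasDerivAt_revPoint ω β)
    have h2 : (fun β => K.F (revPoint c e ρ (β, ω))) = fun _ => 0 :=
      funext fun β => h.apply_revPoint hω β
    rw [h2] at h1
    have h3 := h1.unique (hasDerivAt_const β 0)
    rw [inner_smul_right] at h3
    exact (mul_eq_zero.mp h3).resolve_left (meridianSpeed_pos h.pos β).ne'
  have hu : 0 ≤ inner ℝ (gradient K.F (revPoint c e ρ (β, ω))) (sin β • ω - cos β • e) := by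
    by_contra! hcon
    have h1 := (K.hasDerivAt_ray c (sin β • ω - cos β • e) (ρ β)).neg
    have h2 := eventually_neg_pos_of_hasDerivAt h1 (neg_eq_zero.mpr hF) (neg_pos.mpr hcon)
    have h3 : ∀ᶠ s in 𝓝[>] (0 : ℝ), s < ρ β :=
      nhdsWithin_le_nhds (eventually_lt_nhds (h.pos β))
    obtain ⟨s, hs, hsρ, hs0⟩ := (h2.and (h3.and self_mem_nhdsWithin)).exists
    have hs0' : 0 < s := hs0
    have h4 := (h.neg_iff ω hω β (ρ β - s) (by linarith)).mpr (by linarith)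
    have h5 := hs.1
    simp only [Pi.neg_apply] at h5
    linarith
  have hw : ∀ w, inner ℝ e w = 0 → inner ℝ ω w = 0 →
      inner ℝ (gradient K.F (revPoint c e ρ (β, ω))) w = 0 := by
    intro w hew hωw
    refine h.axial.inner_gradient_eq_zero hF hew ?_
    simp [inner_smul_left, inner_sub_left, hew, hωw]
  rw [normal]
  set G := gradient K.F (revPoint c e ρ (β, ω)) with hG
  set a := inner ℝ G ω with ha
  set b := inner ℝ G e with hb
  set θ := tangentAngle ρ β with hθ
  have hspan : G = a • ω + b • e := by
    have haω : inner ℝ ω G = a := real_inner_comm _ _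
    have hbe : inner ℝ e G = b := real_inner_comm _ _
    have h1 : inner ℝ e (G - (a • ω + b • e)) = 0 := by
      simp [inner_sub_right, inner_add_right, inner_smul_right, heω, he, hbe]
    have h2 : inner ℝ ω (G - (a • ω + b • e)) = 0 := by
      simp [inner_sub_right, inner_add_right, inner_smul_right, hωe, hω.1, haω]
    have h3 := hw _ h1 h2
    have h4 : inner ℝ (G - (a • ω + b • e)) (G - (a • ω + b • e)) = 0 := by
      nth_rewrite 1 [inner_sub_left]
      rw [inner_add_left, inner_smul_left, inner_smul_left, h1, h2, h3]
      simp
    exact sub_eq_zero.mp (inner_self_eq_zero.mp h4)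
  rw [inner_add_right, inner_smul_right, inner_smul_right, ← ha, ← hb] at hτ
  rw [inner_sub_right, inner_smul_right, inner_smul_right, ← ha, ← hb] at hu
  have hsc := sin_sq_add_cos_sq θ
  set l := a * sin θ - b * cos θ with hl
  have hal : a = l * sin θ := by
    rw [hl]; linear_combination (-a) * hsc + cos θ * hτ
  have hbl : b = -(l * cos θ) := by
    rw [hl]; linear_combination (-b) * hsc + sin θ * hτ
  have hGN : G = l • (sin θ • ω - cos θ • e) := by
    rw [hspan]
    nth_rewrite 1 [hal, hbl]
    module
  have hcos : 0 < cos (θ - β) := by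
    have : θ - β = -arctan (deriv ρ β / ρ β) := by rw [hθ, tangentAngle]; ring
    rw [this, cos_neg]
    exact cos_arctan_pos _
  have hl0 : l ≠ 0 := fun h0 => hGne (by rw [hGN, h0, zero_smul])
  have hlpos : 0 < l := by
    refine lt_of_le_of_ne ?_ hl0.symm
    have : sin β * a - cos β * b = l * cos (θ - β) := by
      rw [cos_sub]
      nth_rewrite 1 [hal, hbl]
      ring
    rw [this] at hu
    exact nonneg_of_mul_nonneg_left hu hcos
  have hN : ‖sin θ • ω - cos θ • e‖ = 1 := norm_polar he hω θ
  rw [hGN, norm_smul, hN, mul_one, Real.norm_eq_abs, abs_of_pos hlpos, smul_smul,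
    inv_mul_cancel₀ hl0, one_smul]

theorem abs_tangentAngle_sub_le (h : K.IsRadialGraph c e ρ) (hω : ω ∈ equator e) {β : ℝ}
    (hle : 127 / 128 * ‖gradient K.F (revPoint c e ρ (β, ω))‖ ≤
      inner ℝ (gradient K.F (revPoint c e ρ (β, ω))) (sin β • ω - cos β • e)) :
    |tangentAngle ρ β - β| ≤ 1 / 4 := by
  have hGpos := norm_pos_iff.mpr (K.regular _ (h.apply_revPoint hω β))
  have h1 := h.normal_revPoint hω β
  have hee : inner ℝ e e = 1 := by rw [real_inner_self_eq_norm_sq, h.norm_axis]; norm_num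
  have hωω : inner ℝ ω ω = 1 := by rw [real_inner_self_eq_norm_sq, hω.1]; norm_num
  have heω : inner ℝ e ω = 0 := hω.2
  have hωe : inner ℝ ω e = 0 := by rw [real_inner_comm]; exact hω.2
  have h2 : inner ℝ (K.normal (revPoint c e ρ (β, ω))) (sin β • ω - cos β • e) =
      cos (tangentAngle ρ β - β) := by
    rw [h1, cos_sub]
    simp only [inner_sub_left, inner_sub_right, inner_smul_left, inner_smul_right, hee, hωω, heω,
      hωe, conj_trivial]
    ring
  have h3 : tangentAngle ρ β - β = -arctan (deriv ρ β / ρ β) := by rw [tangentAngle]; ring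
  rw [normal, inner_smul_left, conj_trivial, h3, cos_neg] at h2
  rw [h3, abs_neg]
  apply abs_arctan_le_of_cos_ge
  rw [← h2, inv_mul_eq_div, le_div_iff₀ hGpos]
  exact hle


theorem differentiableAt_normal {x : Euc n} (hx : K.F x = 0) : DifferentiableAt ℝ K.normal x := by
  have hG : DifferentiableAt ℝ (gradient K.F) x :=
    K.contDiff_gradient.differentiable (by norm_num) x
  exact ((hG.norm ℝ (K.regular x hx)).inv (norm_ne_zero_iff.mpr (K.regular x hx))).smul hG

theorem inner_fderiv_normal_eq_zero {x : Euc n} (hx : K.F x = 0) (y : Euc n) :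
    inner ℝ (K.normal x) (fderiv ℝ K.normal x y) = 0 := by
  have h1 := (differentiableAt_normal hx).hasFDerivAt.norm_sq
  have h2 : (fun z => ‖K.normal z‖ ^ 2) =ᶠ[𝓝 x] fun _ => 1 := by
    have h3 : ∀ᶠ z in 𝓝 x, gradient K.F z ≠ 0 :=
      K.contDiff_gradient.continuous.continuousAt.eventually_ne (K.regular x hx)
    filter_upwards [h3] with z hz
    rw [normal, norm_smul, norm_inv, norm_norm, inv_mul_cancel₀ (norm_ne_zero_iff.mpr hz), one_pow]
  have h4 := (h1.congr_of_eventuallyEq h2.symm).unique (hasFDerivAt_const 1 x)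
  have h5 := congrArg (fun L => L y) h4
  simpa using h5

theorem meanCurv_revPoint {m : ℕ} {K : SmoothBody (m + 2)} {c e ω : Euc (m + 2)}
    (h : K.IsRadialGraph c e ρ) (hω : ω ∈ equator e) {β : ℝ} (hβ : sin β ≠ 0) :
    K.meanCurv (revPoint c e ρ (β, ω)) = deriv (tangentAngle ρ) β / meridianSpeed ρ β +
      m * (sin (tangentAngle ρ β) / (ρ β * sin β)) := by
  set x := revPoint c e ρ (β, ω) with hx
  have hF : K.F x = 0 := h.apply_revPoint hω β
  have hee : inner ℝ e e = 1 := by rw [real_inner_self_eq_norm_sq, h.norm_axis]; norm_num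
  have hωω : inner ℝ ω ω = 1 := by rw [real_inner_self_eq_norm_sq, hω.1]; norm_num
  have heω : inner ℝ e ω = 0 := hω.2
  have hωe : inner ℝ ω e = 0 := by rw [real_inner_comm]; exact hω.2
  have hν := (differentiableAt_normal hF).hasFDerivAt
  have hv := (meridianSpeed_pos h.pos β).ne'
  have hr : ρ β * sin β ≠ 0 := mul_ne_zero (h.pos β).ne' hβ
  have hN : K.normal x = _ := h.normal_revPoint hω β
  set D := fderiv ℝ K.normal x with hD
  have hθd : HasDerivAt (tangentAngle ρ) (deriv (tangentAngle ρ) β) β :=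
    ((contDiff_tangentAngle (h.contDiff 2) h.pos).differentiable one_ne_zero β).hasDerivAt
  have hDτ : D (cos (tangentAngle ρ β) • ω + sin (tangentAngle ρ β) • e) =
      (deriv (tangentAngle ρ) β / meridianSpeed ρ β) •
        (cos (tangentAngle ρ β) • ω + sin (tangentAngle ρ β) • e) := by
    have h1 := hν.comp_hasDerivAt β (h.hasDerivAt_revPoint ω β)
    have h2 : K.normal ∘ (fun β => revPoint c e ρ (β, ω)) =
        fun β => sin (tangentAngle ρ β) • ω - cos (tangentAngle ρ β) • e :=
      funext fun β => h.normal_revPoint hω β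
    rw [h2] at h1
    have h3 := h1.unique ((hθd.sin.smul_const ω).sub (hθd.cos.smul_const e))
    rw [map_smul] at h3
    rw [← inv_smul_smul₀ hv (D _), h3, div_eq_inv_mul]
    module
  have hDw : ∀ w : Euc (m + 2), ‖w‖ = 1 → inner ℝ e w = 0 → inner ℝ ω w = 0 →
      D w = (sin (tangentAngle ρ β) / (ρ β * sin β)) • w := by
    intro w hw hew hωw
    have hmem : ∀ s : ℝ, cos s • ω + sin s • w ∈ equator e := by
      intro s
      constructor
      · rw [← pow_eq_one_iff_of_nonneg (norm_nonneg _) two_ne_zero, norm_add_sq_real, norm_smul,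
          norm_smul, hw, hω.1, inner_smul_left, inner_smul_right, hωw]
        simp
      · rw [inner_add_right, inner_smul_right, inner_smul_right, hew, heω]; simp
    have hγ : HasDerivAt (fun s : ℝ => cos s • ω + sin s • w) w 0 := by
      refine (((hasDerivAt_cos 0).smul_const ω).add ((hasDerivAt_sin 0).smul_const w)).congr_deriv ?_
      simp
    have hγ' : HasDerivAt (fun s : ℝ => revPoint c e ρ (β, cos s • ω + sin s • w))
        ((ρ β * sin β) • w) 0 := by
      simp only [revPoint_eq]
      exact ((hγ.const_smul (ρ β * sin β)).add_const _).const_add c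
    have h0 : revPoint c e ρ (β, cos 0 • ω + sin 0 • w) = x := by simp [hx]
    have h1 := HasFDerivAt.comp_hasDerivAt (l := K.normal) (l' := D) 0 (by rw [h0]; exact hν) hγ'
    have h2 : K.normal ∘ (fun s : ℝ => revPoint c e ρ (β, cos s • ω + sin s • w)) =
        fun s => sin (tangentAngle ρ β) • (cos s • ω + sin s • w) - cos (tangentAngle ρ β) • e :=
      funext fun s => h.normal_revPoint (hmem s) β
    rw [h2] at h1
    have h3 := h1.unique ((hγ.const_smul (sin (tangentAngle ρ β))).sub_const _)
    rw [map_smul] at h3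
    rw [← inv_smul_smul₀ hr (D w), h3, smul_smul, div_eq_inv_mul]
  set θ := tangentAngle ρ β with hθ
  have hττ : inner ℝ (cos θ • ω + sin θ • e) (cos θ • ω + sin θ • e) = 1 := by
    simp only [inner_add_left, inner_add_right, inner_smul_left, inner_smul_right, hee, hωω, heω,
      hωe, conj_trivial]
    linear_combination sin_sq_add_cos_sq θ
  have hNτ : inner ℝ (sin θ • ω - cos θ • e) (cos θ • ω + sin θ • e) = 0 := by
    simp only [inner_sub_left, inner_add_right, inner_smul_left, inner_smul_right, hee, hωω, heω,
      hωe, conj_trivial]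
    ring
  obtain ⟨b, hb0, hb1⟩ : ∃ b : OrthonormalBasis (Fin (m + 2)) ℝ (Euc (m + 2)),
      b 0 = sin θ • ω - cos θ • e ∧ b 1 = cos θ • ω + sin θ • e := by
    set f : Fin (m + 2) → Euc (m + 2) :=
      fun i => if i = 0 then sin θ • ω - cos θ • e else cos θ • ω + sin θ • e with hf
    have hf0 : f 0 = sin θ • ω - cos θ • e := by simp [hf]
    have hf1 : f 1 = cos θ • ω + sin θ • e := by simp [hf]
    have hon : Orthonormal ℝ (({0, 1} : Set (Fin (m + 2))).domRestrict f) := by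
      constructor
      · rintro ⟨i, rfl | rfl⟩
        · simpa [Set.domRestrict, hf0] using norm_polar h.norm_axis hω θ
        · rw [← pow_eq_one_iff_of_nonneg (norm_nonneg _) two_ne_zero, ← real_inner_self_eq_norm_sq]
          simpa only [Set.domRestrict, hf1] using hττ
      · rintro ⟨i, rfl | rfl⟩ ⟨j, rfl | rfl⟩ hij
        · exact absurd rfl hij
        · simpa only [Set.domRestrict, hf0, hf1] using hNτ
        · rw [real_inner_comm]
          simpa only [Set.domRestrict, hf0, hf1] using hNτ
        · exact absurd rfl hij
    obtain ⟨b, hb⟩ := hon.exists_orthonormalBasis_extension_of_card_eq (by simp)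
    exact ⟨b, by rw [hb 0 (by simp), hf0], by rw [hb 1 (by simp), hf1]⟩
  have hrest : ∀ i : Fin m, inner ℝ (b i.succ.succ) (D (b i.succ.succ)) =
      sin θ / (ρ β * sin β) := by
    intro i
    have h0 : inner ℝ (sin θ • ω - cos θ • e) (b i.succ.succ) = 0 := by
      rw [← hb0]; exact b.inner_eq_zero (Fin.succ_ne_zero _).symm
    have h1 : inner ℝ (cos θ • ω + sin θ • e) (b i.succ.succ) = 0 := by
      rw [← hb1]; exact b.inner_eq_zero (by simp [Fin.ext_iff])
    simp only [inner_sub_left, inner_add_left, inner_smul_left, conj_trivial] at h0 h1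
    have hsc := sin_sq_add_cos_sq θ
    rw [hDw _ (b.norm_eq_one _), inner_smul_right, b.inner_eq_one, mul_one]
    · linear_combination (-cos θ) * h0 + sin θ * h1 -
        (inner ℝ e (b i.succ.succ)) * hsc
    · linear_combination sin θ * h0 + cos θ * h1 -
        (inner ℝ ω (b i.succ.succ)) * hsc
  rw [meanCurv, divg, LinearMap.trace_eq_sum_inner _ b, Fin.sum_univ_succ, Fin.sum_univ_succ]
  simp only [ContinuousLinearMap.coe_coe, Fin.succ_zero_eq_one]
  rw [← hD, Finset.sum_congr rfl fun i _ => hrest i, hb0, hb1, ← hN,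
    inner_fderiv_normal_eq_zero hF, hDτ, inner_smul_right, hττ]
  simp

end IsRadialGraph
end SmoothBody

theorem exists_mem_equator_inner_eq_zero {n : ℕ} (hn : 3 ≤ n) (e w : Euc n) :
    ∃ ω ∈ equator e, inner ℝ ω w = 0 := by
  classical
  have h1 : Module.finrank ℝ (Submodule.span ℝ (({e, w} : Finset (Euc n)) : Set (Euc n))) ≤ 2 :=
    (finrank_span_finset_le_card _).trans Finset.card_le_two
  have h2 := Submodule.finrank_add_finrank_orthogonal
    (Submodule.span ℝ (({e, w} : Finset (Euc n)) : Set (Euc n)))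
  rw [finrank_euclideanSpace_fin] at h2
  have : Nontrivial (Submodule.span ℝ (({e, w} : Finset (Euc n)) : Set (Euc n)))ᗮ :=
    (Module.finrank_pos_iff (R := ℝ)).mp (by omega)
  obtain ⟨⟨x, hx⟩, hx1⟩ := exists_norm_eq
    (Submodule.span ℝ (({e, w} : Finset (Euc n)) : Set (Euc n)))ᗮ zero_le_one
  refine ⟨x, ⟨hx1, ?_⟩, ?_⟩
  · exact hx e (Submodule.subset_span (by simp))
  · rw [real_inner_comm]
    exact hx w (Submodule.subset_span (by simp))

namespace SmoothBody

variable {n : ℕ} {K : SmoothBody n}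

theorem exists_isRadialGraph (hn : 3 ≤ n) (hK : K.IsPerturbedBall (1 / 8))
    (hsym : AxiallySymmetric K.body) :
    ∃ c e ρ, K.IsRadialGraph c e ρ ∧ (equator e).Nonempty ∧
      ∀ β, |tangentAngle ρ β - β| ≤ 1 / 4 := by
  obtain ⟨c, hc⟩ := hK.exists_center
  obtain ⟨p, d, hd, hsym⟩ := hsym
  have hdn : ‖d‖ ≠ 0 := norm_ne_zero_iff.mpr hd
  set e := ‖d‖⁻¹ • d with he
  have hde : d = ‖d‖ • e := by rw [he, smul_inv_smul₀ hdn]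
  have hen : ‖e‖ = 1 := by rw [he, norm_smul, norm_inv, norm_norm, inv_mul_cancel₀ hdn]
  set s : ℝ := inner ℝ e (c - p) with hs
  obtain ⟨w, hw⟩ : ∃ w, c = p + s • e + w := ⟨c - (p + s • e), by abel⟩
  have hew : inner ℝ e w = 0 := by
    have : w = c - p - s • e := by rw [hw]; abel
    rw [this, inner_sub_right, inner_smul_right, real_inner_self_eq_norm_sq, hen, ← hs]
    ring
  have hax : K.IsAxialAbout (p + s • e) e := by
    intro R hR x hx
    have := hsym R (by rw [hde, map_smul, hR]) _ hx
    have e1 : p + R (p + s • e + x - p) = p + s • e + R x := by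
      rw [show p + s • e + x - p = s • e + x by abel, map_add, map_smul, hR, add_assoc]
    rwa [e1] at this
  obtain ⟨ω₀, hω₀, hωw⟩ := exists_mem_equator_inner_eq_zero hn e w
  rw [hw] at hc
  have hcross := fun (β t : ℝ) ht => hax.ray_crossing (β := β) (t := t) hew hen hω₀ hωw hc ht
  obtain ⟨ρ, hρ, hpos, hiff⟩ := hax.exists_radial hen hω₀ hcross
  have hgraph : K.IsRadialGraph (p + s • e) e ρ :=
    ⟨hax, hen, hρ, hpos, fun ω hω β t ht => (hiff ω hω β t ht).1,
      fun ω hω β t ht => (hiff ω hω β t ht).2⟩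
  exact ⟨_, e, ρ, hgraph, ⟨ω₀, hω₀⟩, fun β => hgraph.abs_tangentAngle_sub_le hω₀
    (hcross β (ρ β) (hpos β).le (hgraph.apply_revPoint hω₀ β)).2⟩

theorem isClosed_bdry : IsClosed K.bdry :=
  isClosed_eq K.smooth.continuous continuous_const

theorem IsRadialGraph.bdry_eq {c e : Euc n} {ρ : ℝ → ℝ} (h : K.IsRadialGraph c e ρ)
    (hne : (equator e).Nonempty) : K.bdry = revPoint c e ρ '' (Icc 0 π ×ˢ equator e) := by
  ext x
  constructor
  · intro hx
    obtain ⟨t, ht, β, hβ, ω, hω, hxt⟩ := exists_polar h.norm_axis hne (x - c)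
    have hx' : x = c + t • (sin β • ω - cos β • e) := by rw [← hxt]; abel
    refine ⟨(β, ω), ⟨hβ, hω⟩, ?_⟩
    have : K.F x = 0 := hx
    rw [hx', h.eq_iff ω hω β t ht] at this
    rw [hx', this, revPoint]
  · rintro ⟨⟨β, ω⟩, ⟨-, hω⟩, rfl⟩
    exact h.apply_revPoint hω β

/-- The mean curvature as a function of the polar angle. -/
def profileCurv (m : ℕ) (ρ : ℝ → ℝ) (β : ℝ) : ℝ :=
  deriv (tangentAngle ρ) β / meridianSpeed ρ β + m * (sin (tangentAngle ρ β) / (ρ β * sin β))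

theorem profileCurv_mul_revDensity {m : ℕ} (hm : 1 ≤ m) {ρ : ℝ → ℝ} (hpos : ∀ β, 0 < ρ β) {β : ℝ}
    (hβ : β ∈ Ioo 0 π) : max (profileCurv m ρ β) 0 * revDensity m ρ β =
      max (deriv (tangentAngle ρ) β * (ρ β * sin β) ^ m +
        m * meridianSpeed ρ β * sin (tangentAngle ρ β) * (ρ β * sin β) ^ (m - 1)) 0 := by
  have hv := (meridianSpeed_pos hpos β).ne'
  have hr : ρ β * sin β ≠ 0 := (mul_pos (hpos β) (sin_pos_of_mem_Ioo hβ)).ne'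
  rw [max_mul_of_nonneg _ _ (revDensity_pos m hpos hβ).le, zero_mul]
  obtain ⟨k, rfl⟩ : ∃ k, m = k + 1 := ⟨m - 1, by omega⟩
  congr 1
  rw [profileCurv, revDensity, Nat.add_sub_cancel]
  generalize ρ β * sin β = r at hr
  field_simp
  ring

theorem IsRadialGraph.curvature_bound {c e : Euc n} {ρ : ℝ → ℝ} (h : K.IsRadialGraph c e ρ)
    (hang : ∀ β, |tangentAngle ρ β - β| ≤ 1 / 4) {m : ℕ} (hm : 1 ≤ m) :
    (m + 1) * ((∫ β in 0..π, revDensity m ρ β) ^ ((m : ℝ) / (m + 1)) *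
        (∫ β in 0..π, sin β ^ m) ^ (1 / ((m : ℝ) + 1))) ≤
      ∫ β in 0..π, max (profileCurv m ρ β) 0 * revDensity m ρ β := by
  have hθ := contDiff_tangentAngle (h.contDiff 2) h.pos
  have hb := meridian_curvature_bound hm (r := fun β => ρ β * sin β)
    (continuous_meridianSpeed h.contDiff_one) (meridianSpeed_pos h.pos)
    (hθ.continuous_deriv le_rfl)
    (fun β => (hθ.differentiable one_ne_zero β).hasDerivAt)
    (hasDerivAt_mul_sin h.contDiff_one h.pos) (by simp) (by simp)
    (fun β hβ => mul_pos (h.pos β) (sin_pos_of_mem_Ioo hβ))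
    (fun β hβ => by
      have := abs_le.mp (hang β)
      constructor <;> linarith [hβ.1, hβ.2])
  refine hb.trans_eq ?_
  exact intervalIntegral.integral_congr_Ioo_of_le pi_pos.le fun β hβ =>
    (profileCurv_mul_revDensity hm h.pos hβ).symm

end SmoothBody

theorem rpow_div_le_rpow_div {m : ℕ} (hm : 1 ≤ m) {κ A A₀ B : ℝ} (hκ : 0 < κ) (hA : 0 < A)
    (hA₀ : 0 < A₀)
    (hB : (m + 1) * (A ^ ((m : ℝ) / (m + 1)) * A₀ ^ (1 / ((m : ℝ) + 1))) ≤ B) :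
    (((m : ℝ) + 1) * (κ * A₀)) ^ ((m : ℝ)⁻¹) / (κ * A₀) ^ (((m : ℝ) + 1)⁻¹) ≤
      (κ * B) ^ ((m : ℝ)⁻¹) / (κ * A) ^ (((m : ℝ) + 1)⁻¹) := by
  have hm0 : m ≠ 0 := by omega
  have hm1 : (m : ℝ) + 1 ≠ 0 := by positivity
  set P := (κ * A) ^ (((m : ℝ) + 1)⁻¹) with hP
  set Q := (κ * A₀) ^ (((m : ℝ) + 1)⁻¹) with hQ
  have hPpos : 0 < P := by positivity
  have hQpos : 0 < Q := by positivity
  have hQ' : κ * A₀ = Q * Q ^ m := by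
    rw [← pow_succ', hQ, ← rpow_natCast, ← rpow_mul (by positivity)]
    push_cast
    rw [inv_mul_cancel₀ hm1, rpow_one]
  have hPQ : P ^ m * Q = κ * (A ^ ((m : ℝ) / (m + 1)) * A₀ ^ (1 / ((m : ℝ) + 1))) := by
    rw [hP, ← rpow_natCast, ← rpow_mul (by positivity), inv_mul_eq_div, hQ,
      mul_rpow hκ.le hA.le, mul_rpow hκ.le hA₀.le, one_div]
    have : κ ^ ((m : ℝ) / (m + 1)) * κ ^ (((m : ℝ) + 1)⁻¹) = κ := by
      rw [← rpow_add hκ, ← one_div, ← add_div, div_self hm1, rpow_one]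
    linear_combination A ^ ((m : ℝ) / (m + 1)) * A₀ ^ (((m : ℝ) + 1)⁻¹) * this
  have hroot : ∀ x : ℝ, 0 < x →
      (((m : ℝ) + 1) * Q * x ^ m) ^ ((m : ℝ)⁻¹) / x = (((m : ℝ) + 1) * Q) ^ ((m : ℝ)⁻¹) := by
    intro x hx
    rw [mul_rpow (by positivity) (by positivity), pow_rpow_inv_natCast hx.le hm0,
      mul_div_cancel_right₀ _ hx.ne']
  rw [hQ', ← mul_assoc, hroot Q hQpos, ← hroot P hPpos]
  have : ((m : ℝ) + 1) * Q * P ^ m ≤ κ * B := by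
    calc ((m : ℝ) + 1) * Q * P ^ m = (m + 1) * (P ^ m * Q) := by ring
      _ = κ * ((m + 1) * (A ^ ((m : ℝ) / (m + 1)) * A₀ ^ (1 / ((m : ℝ) + 1)))) := by
        rw [hPQ]; ring
      _ ≤ κ * B := by gcongr
  gcongr

end

/-- For every `n ≥ 3` there exists `ε₂ = ε₂(n) > 0` such that for every
axially symmetric `K ⊆ ℝⁿ` which is a `C¹` `ε₂`-perturbation of a ball,
`(∫_{∂K} H⁺ dH^{n-1})^{1/(n-2)} / Per(K)^{1/(n-1)}
  ≥ ((n-1)·H^{n-1}(S^{n-1}))^{1/(n-2)} / Per(B₁)^{1/(n-1)}`. -/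
theorem minkowski_axially_symmetric (n : ℕ) (hn : 3 ≤ n) :
    ∃ ε₂ : ℝ, 0 < ε₂ ∧ ∀ K : SmoothBody n, K.IsPerturbedBall ε₂ →
      AxiallySymmetric K.body →
      (∫ x in K.bdry, max (K.meanCurv x) 0 ∂μH[(n : ℝ) - 1]) ^ (((n : ℝ) - 2)⁻¹)
          / K.perim ^ (((n : ℝ) - 1)⁻¹)
        ≥ (((n : ℝ) - 1) * sphereArea n) ^ (((n : ℝ) - 2)⁻¹)
          / (sphereArea n) ^ (((n : ℝ) - 1)⁻¹) := by
  refine ⟨1 / 8, by norm_num, fun K hK hsym => ?_⟩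
  obtain ⟨c, e, ρ, h, hne, hang⟩ := K.exists_isRadialGraph hn hK hsym
  obtain ⟨m, rfl⟩ : ∃ m, n = m + 2 := ⟨n - 2, by omega⟩
  have hm : 1 ≤ m := by omega
  have hd1 : ((m + 2 : ℕ) : ℝ) - 1 = m + 1 := by push_cast; ring
  have hd2 : ((m + 2 : ℕ) : ℝ) - 2 = m := by push_cast; ring
  rw [SmoothBody.perim, sphereArea, hd1, hd2]
  have hm0 : (m : ℝ)⁻¹ ≠ 0 := by positivity
  set S := (μH[(m : ℝ) + 1] (sphere (0 : Euc (m + 2)) 1)).toReal with hS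
  have hI : 0 ≤ ∫ x in K.bdry, max (K.meanCurv x) 0 ∂μH[(m : ℝ) + 1] :=
    integral_nonneg fun x => le_max_right _ _
  by_cases hS0 : S = 0
  · rw [hS0, mul_zero, zero_rpow hm0, zero_div]
    positivity
  have hfin : μH[(m : ℝ) + 1] (sphere (0 : Euc (m + 2)) 1) ≠ ∞ := fun htop => hS0 (by
    rw [hS, htop, ENNReal.toReal_top])
  obtain ⟨κ, hκ⟩ := exists_cylinder_const h.norm_axis (by positivity) hfin
  have hbdry := h.bdry_eq hne
  have hbm : MeasurableSet (revPoint c e ρ '' (Icc 0 π ×ˢ equator e)) :=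
    hbdry ▸ K.isClosed_bdry.measurableSet
  have hsph := sphere_eq_revPoint_image h.norm_axis hne
  have hsm : MeasurableSet (revPoint 0 e (fun _ => 1) '' (Icc 0 π ×ˢ equator e)) :=
    hsph ▸ isClosed_sphere.measurableSet
  have hper : (μH[(m : ℝ) + 1] K.bdry).toReal = κ * ∫ β in 0..π, revDensity m ρ β := by
    have := integral_revPoint_image h.norm_axis hκ c h.contDiff_one h.pos hbm
      (f := fun _ => 1) (h := fun _ => 1) measurable_const fun _ _ => rfl
    rw [← hbdry] at this
    simpa [Measure.real] using this
  have hsphere : S = κ * ∫ β in 0..π, sin β ^ m := by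
    have := integral_revPoint_image h.norm_axis hκ 0 contDiff_const (fun _ => one_pos) hsm
      (f := fun _ => 1) (h := fun _ => 1) measurable_const fun _ _ => rfl
    rw [← hsph] at this
    simpa [Measure.real, revDensity, meridianSpeed] using this
  have hcurv : ∫ x in K.bdry, max (K.meanCurv x) 0 ∂μH[(m : ℝ) + 1] =
      κ * ∫ β in 0..π, max (SmoothBody.profileCurv m ρ β) 0 * revDensity m ρ β := by
    rw [hbdry]
    refine integral_revPoint_image h.norm_axis hκ c h.contDiff_one h.pos hbm ?_ ?_
    · have hθ := contDiff_tangentAngle (h.contDiff 2) h.pos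
      have m1 := (hθ.continuous_deriv le_rfl).measurable
      have m2 := (continuous_meridianSpeed h.contDiff_one).measurable
      have m3 := hθ.continuous.measurable
      have m4 := h.contDiff_one.continuous.measurable
      unfold SmoothBody.profileCurv
      fun_prop
    · rintro ⟨β, ω⟩ ⟨hβ, hω⟩
      simp only
      rw [h.meanCurv_revPoint hω (sin_pos_of_mem_Ioo hβ).ne', SmoothBody.profileCurv]
  have hκ0 : (0 : ℝ) < κ := by
    refine lt_of_le_of_ne κ.2 fun h0 => hS0 ?_
    rw [hsphere, ← h0, zero_mul]
  have hA : 0 < ∫ β in 0..π, revDensity m ρ β :=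
    intervalIntegral.intervalIntegral_pos_of_pos_on
      ((continuous_revDensity m h.contDiff_one).intervalIntegrable _ _)
      (fun β hβ => revDensity_pos m h.pos hβ) pi_pos
  rw [hper, hsphere, hcurv]
  exact rpow_div_le_rpow_div hm hκ0 hA (integral_sin_pow_pos m) (h.curvature_bound hang hm)
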